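/- arXiv:math/9406228 — 4 statements merged into one kernel-verified Lean document; each statement's English description precedes it below -/
import Mathlib

section
/- Every null-additive subset of Cantor space is meager-additive. -/
open MeasureTheory Pointwise

/-- Cantor space `2^ω` with componentwise addition mod 2. -/
abbrev Cantor : Type := ℕ → ZMod 2
/-- Finite binary sequences, the nodes of `2^{<ω}`. -/
abbrev FinSeq : Type := List (ZMod 2)

instance : TopologicalSpace (ZMod 2) := ⊥
instance : DiscreteTopology (ZMod 2) := ⟨rfl⟩
noncomputable instance : MeasurableSpace Cantor := borel Cantor
instance : BorelSpace Cantor := ⟨rfl⟩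

/-- The uniform (Lebesgue) product measure on `2^ω`, realized as the Haar measure of the
compact group `2^ω` normalized so that the whole space has measure 1. -/
noncomputable def μC : Measure Cantor := Measure.addHaarMeasure ⊤

/-- `X` is null-additive: `X + A` is null for every null `A`. -/
def NullAdditive (X : Set Cantor) : Prop := ∀ A : Set Cantor, μC A = 0 → μC (X + A) = 0

/-- `X` is meager-additive: `X + A` is meager for every meager `A`. -/
def MeagerAdditive (X : Set Cantor) : Prop := ∀ A : Set Cantor, IsMeagre A → IsMeagre (X + A)

/-- A tree on `2^{<ω}`: nonempty, closed under initial segments, and every node has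
extensions in the tree of every greater length. -/
def IsTree (T : Set FinSeq) : Prop :=
  T.Nonempty ∧ (∀ σ τ : FinSeq, σ <+: τ → τ ∈ T → σ ∈ T) ∧
    ∀ σ ∈ T, ∀ n, σ.length < n → ∃ τ ∈ T, σ <+: τ ∧ τ.length = n

/-- Restriction `x↾n` of `x ∈ 2^ω`. -/
def res (x : Cantor) (n : ℕ) : FinSeq := (List.range n).map x

/-- `Lim T = {x ∈ 2^ω : ∀ n, x↾n ∈ T}`. -/
def LimT (T : Set FinSeq) : Set Cantor := {x | ∀ n, res x n ∈ T}

/-- A nowhere dense tree: every node has an extension outside the tree. -/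
def NwdTree (T : Set FinSeq) : Prop := ∀ η ∈ T, ∃ τ : FinSeq, η <+: τ ∧ τ ∉ T

/-- Componentwise mod-2 addition of finite sequences (of the same length). -/
def finAdd : FinSeq → FinSeq → FinSeq := List.zipWith (· + ·)

/-- `T + S = {η + σ : η ∈ T, σ ∈ S, same length}`. -/
def treeSum (T S : Set FinSeq) : Set FinSeq :=
  {ρ | ∃ η ∈ T, ∃ σ ∈ S, η.length = σ.length ∧ ρ = finAdd η σ}

/-- `T^{[η]} = {τ ∈ T : τ ⊑ η or η ⊑ τ}`. -/
def through (T : Set FinSeq) (η : FinSeq) : Set FinSeq := {τ ∈ T | τ <+: η ∨ η <+: τ}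

/-- `A^{fin}`: points agreeing with some point of `A` at all but finitely many coordinates. -/
def finEq (A : Set Cantor) : Set Cantor := {y | ∃ x ∈ A, ∀ᶠ n in Filter.atTop, y n = x n}

/-- `U^{⟨ν⟩} = {τ : ν⌢τ ∈ U}`. -/
def above (U : Set FinSeq) (ν : FinSeq) : Set FinSeq := {τ | ν ++ τ ∈ U}

/-- A corset: a nondecreasing function `ω → ω \ {0}` tending to infinity. -/
def Corset (f : ℕ → ℕ) : Prop :=
  Monotone f ∧ (∀ n, 0 < f n) ∧ Filter.Tendsto f Filter.atTop Filter.atTop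

/-- `S` is of width `f`: `|S ∩ 2^n| ≤ f n` for all `n`. -/
def widthLe (S : Set FinSeq) (f : ℕ → ℕ) : Prop := ∀ n, {τ ∈ S | τ.length = n}.ncard ≤ f n

/-- `S` is almost of width `f`: `|S ∩ 2^n| ≤ f n` for all sufficiently large `n`. -/
def almostWidthLe (S : Set FinSeq) (f : ℕ → ℕ) : Prop :=
  ∀ᶠ n in Filter.atTop, {τ ∈ S | τ.length = n}.ncard ≤ f n

open ProbabilityTheory Filter Topology

instance instProbμC : IsProbabilityMeasure μC := by
  constructor
  have := Measure.addHaarMeasure_self (K₀ := (⊤ : TopologicalSpace.PositiveCompacts Cantor))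
  simpa [μC] using this

instance instInvμC : μC.IsAddLeftInvariant := by unfold μC; infer_instance
instance instRegμC : μC.Regular := by unfold μC; infer_instance

theorem uniform_hom {H : Type} [AddCommGroup H] [Fintype H] (φ : Cantor →+ H)
    (hm : ∀ h, MeasurableSet (φ ⁻¹' {h})) (hs : Function.Surjective φ) (S : Finset H) :
    μC (φ ⁻¹' (S : Set H)) = (S.card : ENNReal) / (Fintype.card H : ENNReal) := by
  classical
  have h1 : ∀ h, μC (φ ⁻¹' {h}) = μC (φ ⁻¹' {0}) := by
    intro h
    obtain ⟨x, hx⟩ := hs h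
    rw [← measure_preimage_add μC x (φ ⁻¹' {h})]
    congr 1
    ext z
    simp [hx]
  have h2 : ∀ S : Finset H, μC (φ ⁻¹' (S : Set H)) = S.card * μC (φ ⁻¹' {0}) := by
    intro S
    have : φ ⁻¹' (S : Set H) = ⋃ h ∈ S, φ ⁻¹' {h} := by ext z; simp
    rw [this, measure_biUnion_finset _ (fun h _ => hm h)]
    · simp [h1]
    · intro a _ b _ hab
      exact Disjoint.preimage _ (by simpa using hab)
  have h3 := h2 Finset.univ
  simp only [Finset.coe_univ, Set.preimage_univ, measure_univ, Finset.card_univ] at h3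
  have hne : (Fintype.card H : ENNReal) ≠ 0 := by simp
  have h4 : μC (φ ⁻¹' {0}) = (Fintype.card H : ENNReal)⁻¹ := by
    apply ENNReal.eq_inv_of_mul_eq_one_left
    rw [mul_comm, ← h3]
  rw [h2, h4, div_eq_mul_inv]

theorem indep_hom {H : ℕ → Type} [∀ n, AddCommGroup (H n)] [∀ n, Fintype (H n)]
    (φ : ∀ n, Cantor →+ H n) (hm : ∀ n (S : Set (H n)), MeasurableSet (φ n ⁻¹' S))
    (hs : ∀ c : ∀ n, H n, ∃ x, ∀ n, φ n x = c n) (S : ∀ n, Set (H n)) :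
    iIndepSet (fun n => φ n ⁻¹' S n) μC := by
  classical
  rw [iIndepSet_iff_meas_biInter (fun n => hm n _)]
  intro s
  have hsurj : ∀ n, Function.Surjective (φ n) := by
    intro n h
    obtain ⟨x, hx⟩ := hs (Function.update 0 n h)
    exact ⟨x, by simp [hx]⟩
  let Φ : Cantor →+ (∀ n : s, H n) := AddMonoidHom.mk' (fun x n => φ n x) (by
    intro a b; ext n; simp)
  have hΦ : Function.Surjective Φ := by
    intro c
    obtain ⟨x, hx⟩ := hs (fun n => if h : n ∈ s then c ⟨n, h⟩ else 0)
    refine ⟨x, ?_⟩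
    ext n
    simp [Φ, hx]
  have key : (⋂ i ∈ s, φ i ⁻¹' S i) =
      Φ ⁻¹' ((Fintype.piFinset (fun n : s => (S n).toFinset) : Finset _) : Set (∀ n : s, H n)) := by
    ext x
    simp [Φ, Set.mem_pi]
  rw [key, uniform_hom Φ _ hΦ, Fintype.card_piFinset, Fintype.card_pi]
  · have : ∀ i, μC (φ i ⁻¹' S i) = ((S i).toFinset.card : ENNReal) / (Fintype.card (H i) : ENNReal) := by
      intro i
      rw [← uniform_hom (φ i) (fun h => hm i _) (hsurj i)]
      simp
    simp only [this]
    push_cast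
    rw [← Finset.prod_coe_sort s]
    rw [ENNReal.prod_div_distrib]
    · intro i _ j _ _; simp
  · intro h
    have : Φ ⁻¹' {h} = ⋂ n : s, φ n ⁻¹' {h n} := by
      ext x
      simp only [Set.mem_preimage, Set.mem_singleton_iff, Set.mem_iInter]
      exact funext_iff
    rw [this]
    exact MeasurableSet.iInter fun n => hm _ _

theorem covering (X : Set Cantor) (hX : NullAdditive X) (B : ℕ → Set Cantor)
    (hB : ∀ n, IsClopen (B n)) (hsum : ∑' n, μC (B n) ≠ ⊤) :
    ∃ (P : ℕ → Set Cantor) (m : ℕ → ℕ), (∀ i, μC (P i) ≠ 0) ∧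
      ∀ x ∈ X, ∃ i, ∀ z ∈ P i, ∀ n ≥ m i, z - x ∉ B n := by
  have hG := hX _ (measure_limsup_atTop_eq_zero hsum)
  set G := limsup B atTop with hGdef
  set W := toMeasurable μC (X + G)
  have hW : μC W = 0 := by rw [measure_toMeasurable]; exact hG
  have hWc : μC Wᶜ = 1 := by
    rw [prob_compl_eq_one_iff (measurableSet_toMeasurable _ _)]; exact hW
  obtain ⟨K, hKW, hKc, hK0⟩ := (measurableSet_toMeasurable μC (X + G)).compl.exists_lt_isCompact
    (μ := μC) (r := 0) (by change 0 < μC Wᶜ; rw [hWc]; simp)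
  let Bs := TopologicalSpace.countableBasis Cantor
  have hBs : Bs.Countable := TopologicalSpace.countable_countableBasis _
  have hbas := TopologicalSpace.isBasis_countableBasis Cantor
  let N : Set (Set Cantor) := {U ∈ Bs | μC (K ∩ U) = 0}
  have hN : μC (⋃ U ∈ N, K ∩ U) = 0 := by
    rw [measure_biUnion_null_iff (hBs.mono (Set.sep_subset _ _))]
    exact fun U hU => hU.2
  let K' := K \ ⋃ U ∈ N, U
  have hK'cl : IsClosed K' := by
    apply hKc.isClosed.sdiff
    exact isOpen_biUnion fun U hU => hbas.isOpen hU.1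
  have hKK' : ∀ U, μC (K' ∩ U) = 0 → μC (K ∩ U) = 0 := by
    intro U hU
    refine measure_mono_null (t := (K' ∩ U) ∪ ⋃ U ∈ N, K ∩ U) ?_ (measure_union_null hU hN)
    intro z hz
    by_cases h : z ∈ ⋃ U ∈ N, U
    · right
      simp only [Set.mem_iUnion] at h ⊢
      obtain ⟨V, hV, hzV⟩ := h
      exact ⟨V, hV, hz.1, hzV⟩
    · left; exact ⟨⟨hz.1, h⟩, hz.2⟩
  have hpos : ∀ U ∈ Bs, (K' ∩ U).Nonempty → μC (K' ∩ U) ≠ 0 := by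
    rintro U hU ⟨z, hz, hzU⟩ h0
    exact hz.2 (Set.mem_biUnion (show U ∈ N from ⟨hU, hKK' U h0⟩) hzU)
  have hK'ne : K'.Nonempty := by
    rw [Set.nonempty_iff_ne_empty]
    intro h
    have := hKK' Set.univ (by simp [h])
    simp at this
    exact hK0.ne' this
  let Q : Set (Set Cantor × ℕ) := {U ∈ Bs | (K' ∩ U).Nonempty} ×ˢ Set.univ
  have hQc : Q.Countable := (hBs.mono (Set.sep_subset _ _)).prod (Set.to_countable _)
  have hQne : Q.Nonempty := by
    obtain ⟨z, hz⟩ := hK'ne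
    obtain ⟨U, hU, hzU, -⟩ := hbas.exists_subset_of_mem_open (Set.mem_univ z) isOpen_univ
    exact ⟨(U, 0), ⟨hU, z, hz, hzU⟩, trivial⟩
  obtain ⟨e, he⟩ := hQc.exists_eq_range hQne
  refine ⟨fun i => K' ∩ (e i).1, fun i => (e i).2, ?_, ?_⟩
  · intro i
    have : e i ∈ Q := he ▸ Set.mem_range_self i
    exact hpos _ this.1.1 this.1.2
  · intro x hx
    have : CompactSpace K' := isCompact_iff_compactSpace.mp (hK'cl.isCompact)
    have : Nonempty K' := hK'ne.to_subtype
    let C : ℕ → Set K' := fun m => {z | ∀ n ≥ m, (z : Cantor) - x ∉ B n}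
    have hC : ∀ m, IsClosed (C m) := by
      intro m
      have : C m = ⋂ n ≥ m, (fun z : K' => (z : Cantor) - x) ⁻¹' (B n)ᶜ := by
        ext z; simp [C]
      rw [this]
      refine isClosed_biInter fun n _ => ?_
      exact (hB n).compl.isClosed.preimage (by fun_prop)
    have hU : ⋃ m, C m = Set.univ := by
      rw [Set.eq_univ_iff_forall]
      intro z
      by_contra hcon
      have : (z : Cantor) - x ∈ G := by
        rw [hGdef, limsup_eq_iInf_iSup_of_nat]
        simp only [Set.iInf_eq_iInter, Set.iSup_eq_iUnion, Set.mem_iInter, Set.mem_iUnion]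
        intro m
        by_contra h
        apply hcon
        rw [Set.mem_iUnion]
        refine ⟨m, fun n hn hz => h ⟨n, hn, hz⟩⟩
      apply hKW z.2.1
      apply subset_toMeasurable
      exact ⟨x, hx, _, this, by simp⟩
    obtain ⟨m, y, hy⟩ := nonempty_interior_of_iUnion_of_closed hC hU
    obtain ⟨O, hO, hOC⟩ := isOpen_induced_iff.mp (isOpen_interior (s := C m))
    have hyO : (y : Cantor) ∈ O := by
      have : y ∈ Subtype.val ⁻¹' O := hOC ▸ hy
      exact this
    obtain ⟨U, hU, hyU, hUO⟩ := hbas.exists_subset_of_mem_open hyO hO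
    have hmem : (U, m) ∈ Q := ⟨⟨hU, y, y.2, hyU⟩, trivial⟩
    rw [he] at hmem
    obtain ⟨i, hi⟩ := hmem
    refine ⟨i, ?_⟩
    simp only [hi]
    rintro z ⟨hz, hzU⟩ n hn
    have : (⟨z, hz⟩ : K') ∈ interior (C m) := by
      rw [← hOC]; exact hUO hzU
    exact interior_subset this n hn

theorem open_guess (U : Set Cantor) (hU : IsOpen U) (hd : Dense U) (p : ℕ) :
    ∃ (q : ℕ) (a : Cantor), p < q ∧ ∀ z : Cantor, (∀ j, p ≤ j → j < q → z j = a j) → z ∈ U := by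
  classical
  let ext0 : (Fin p → ZMod 2) → Cantor := fun t j => if h : j < p then t ⟨j, h⟩ else 0
  have hfin : ∀ s : Finset (Fin p → ZMod 2),
      IsOpen (⋂ t ∈ s, {z | z + ext0 t ∈ U}) ∧ Dense (⋂ t ∈ s, {z | z + ext0 t ∈ U}) := by
    intro s
    induction s using Finset.induction_on with
    | empty => simp
    | insert t s _ ih =>
      have ho : IsOpen {z | z + ext0 t ∈ U} := hU.preimage (by fun_prop : Continuous fun z => z + ext0 t)
      have hdt : Dense {z | z + ext0 t ∈ U} :=
        hd.preimage (Homeomorph.addRight (ext0 t)).isOpenMap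
      rw [Finset.set_biInter_insert]
      exact ⟨ho.inter ih.1, hdt.inter_of_isOpen_left ih.2 ho⟩
  obtain ⟨ho, hdd⟩ := hfin Finset.univ
  obtain ⟨a, ha⟩ := hdd.nonempty
  obtain ⟨I, u, hu, hsub⟩ := isOpen_pi_iff.mp ho a ha
  refine ⟨max (p + 1) (I.sup id + 1), a, by omega, ?_⟩
  intro z hz
  let t : Fin p → ZMod 2 := fun j => z j - a j
  have hmem : z - ext0 t ∈ (I : Set ℕ).pi u := by
    intro j hj
    have : (z - ext0 t) j = a j := by
      by_cases h : j < p
      · simp [ext0, t, h]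
      · have : j ≤ I.sup id := Finset.le_sup (f := id) hj
        simp [ext0, h, hz j (by omega) (by omega)]
    rw [this]
    exact (hu j hj).2
  have := hsub hmem
  simp only [Set.mem_iInter] at this
  simpa using this t (Finset.mem_univ _)

open Classical in
theorem meagre_guess (A : Set Cantor) (hA : IsMeagre A) :
    ∃ (f : ℕ → ℕ) (a : Cantor), StrictMono f ∧
      ∀ z ∈ A, ∀ᶠ k in atTop, ∃ j, f k ≤ j ∧ j < f (k + 1) ∧ z j ≠ a j := by
  obtain ⟨S, hSo, hSd, hSc, hSA⟩ := mem_residual_iff.mp hA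
  obtain ⟨e, he⟩ := (hSc.insert Set.univ).exists_eq_range (Set.insert_nonempty _ _)
  have heo : ∀ n, IsOpen (e n) ∧ Dense (e n) := by
    intro n
    have : e n ∈ insert Set.univ S := he ▸ Set.mem_range_self n
    rcases this with h | h
    · rw [h]; exact ⟨isOpen_univ, dense_univ⟩
    · exact ⟨hSo _ h, hSd _ h⟩
  let W : ℕ → Set Cantor := fun k => ⋂ n ∈ Finset.range (k + 1), e n
  have hW : ∀ k, IsOpen (W k) ∧ Dense (W k) := by
    intro k
    have : ∀ s : Finset ℕ, IsOpen (⋂ n ∈ s, e n) ∧ Dense (⋂ n ∈ s, e n) := by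
      intro s
      induction s using Finset.induction_on with
      | empty => simp
      | insert t s _ ih =>
        rw [Finset.set_biInter_insert]
        exact ⟨(heo t).1.inter ih.1, (heo t).2.inter_of_isOpen_left ih.2 (heo t).1⟩
    exact this _
  choose q s hq hs using fun k p => open_guess (W k) (hW k).1 (hW k).2 p
  obtain ⟨f, hf⟩ : ∃ f : ℕ → ℕ, ∀ k, f (k + 1) = q k (f k) :=
    ⟨fun k => Nat.rec (motive := fun _ => ℕ) 0 (fun k p => q k p) k, fun _ => rfl⟩
  have hmono : StrictMono f := strictMono_nat_of_lt_succ fun k => by rw [hf]; exact hq _ _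
  let a : Cantor := fun j => if h : ∃ k, f k ≤ j ∧ j < f (k + 1) then s h.choose (f h.choose) j else 0
  have ha : ∀ k j, f k ≤ j → j < f (k + 1) → a j = s k (f k) j := by
    intro k j h1 h2
    have h : ∃ k, f k ≤ j ∧ j < f (k + 1) := ⟨k, h1, h2⟩
    have heq : h.choose = k := by
      have hc := h.choose_spec
      have h5 : f h.choose < f (k + 1) := lt_of_le_of_lt hc.1 h2
      have h6 : f k < f (h.choose + 1) := lt_of_le_of_lt h1 hc.2
      have h3 := hmono.lt_iff_lt.mp h5
      have h4 := hmono.lt_iff_lt.mp h6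
      omega
    simp only [a, dif_pos h, heq]
  refine ⟨f, a, hmono, ?_⟩
  intro z hz
  by_contra hcon
  rw [not_eventually] at hcon
  have hzmem : z ∈ Aᶜ := by
    apply hSA
    intro V hV
    have : V ∈ insert Set.univ S := Or.inr hV
    rw [he] at this
    obtain ⟨n, rfl⟩ := this
    obtain ⟨k, hk, hkn⟩ := frequently_atTop.mp hcon n
    push Not at hkn
    have : z ∈ W k := by
      apply hs k (f k)
      intro j h1 h2
      rw [← hf] at h2
      rw [← ha k j h1 h2]
      exact hkn j h1 h2
    simp only [W, Set.mem_iInter] at this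
    exact this n (by simp; omega)
  exact hzmem hz

/-- converse direction -/
theorem meagre_of_avoid (E : ℕ → Finset ℕ) (hE : ∀ n, ∃ m, ∀ k ≥ m, ∀ j ∈ E k, n ≤ j) (y : Cantor) :
    IsMeagre {w : Cantor | ∀ᶠ n in atTop, ∃ j ∈ E n, w j ≠ y j} := by
  have : {w : Cantor | ∀ᶠ n in atTop, ∃ j ∈ E n, w j ≠ y j} =
      ⋃ m, {w : Cantor | ∀ n ≥ m, ∃ j ∈ E n, w j ≠ y j} := by
    ext w; simp [eventually_atTop]
  rw [this]
  refine isMeagre_iUnion fun m => IsNowhereDense.isMeagre ?_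
  have hcl : IsClosed {w : Cantor | ∀ n ≥ m, ∃ j ∈ E n, w j ≠ y j} := by
    have : {w : Cantor | ∀ n ≥ m, ∃ j ∈ E n, w j ≠ y j} =
      ⋂ n ≥ m, ⋃ j ∈ E n, (fun w : Cantor => w j) ⁻¹' {y j}ᶜ := by
      ext w; simp
    rw [this]
    refine isClosed_biInter fun n _ => isClosed_biUnion_finset fun j _ => ?_
    exact (isClosed_discrete _).preimage (continuous_apply j)
  rw [hcl.isNowhereDense_iff, Set.eq_empty_iff_forall_notMem]
  intro w hw
  obtain ⟨I, u, hu, hsub⟩ := isOpen_pi_iff.mp isOpen_interior w hw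
  obtain ⟨m', hm'⟩ := hE (I.sup id + 1)
  let w' : Cantor := fun j => if j ≤ I.sup id then w j else y j
  have : w' ∈ (I : Set ℕ).pi u := by
    intro j hj
    have hle : j ≤ I.sup id := Finset.le_sup (f := id) hj
    simp only [w', if_pos hle]
    exact (hu j hj).2
  obtain ⟨j, hj, hne⟩ := interior_subset (hsub this) (max m m') (le_max_left _ _)
  have := hm' _ (le_max_right m m') j hj
  apply hne
  simp only [w', if_neg (show ¬ j ≤ I.sup id by omega)]

/-- counting -/
theorem count_bound {V R : Type} [AddCommGroup V] [Fintype V] [DecidableEq V] [AddCommGroup R]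
    [Fintype R] [DecidableEq R] (L : Finset V) (c : V → V → R) :
    (Finset.univ.filter (fun p : (V → R) × V => ∀ d ∈ L, p.1 (p.2 - d) ≠ c d (p.2 - d))).card *
      (Fintype.card R) ^ L.card ≤
    (Fintype.card R - 1) ^ L.card * Fintype.card ((V → R) × V) := by
  have hfib : ∀ v : V, (Finset.univ.filter
      (fun h : V → R => ∀ d ∈ L, h (v - d) ≠ c d (v - d))).card * (Fintype.card R) ^ L.card =
      (Fintype.card R - 1) ^ L.card * Fintype.card (V → R) := by
    intro v
    have h1 : (Finset.univ.filter (fun h : V → R => ∀ d ∈ L, h (v - d) ≠ c d (v - d))) =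
        Fintype.piFinset (fun t => if v - t ∈ L then {c (v - t) t}ᶜ else Finset.univ) := by
      ext h
      simp only [Finset.mem_filter, Finset.mem_univ, true_and, Fintype.mem_piFinset]
      constructor
      · intro hh t
        split_ifs with ht
        · have := hh _ ht
          simpa using this
        · simp
      · intro hh d hd
        have := hh (v - d)
        simpa [hd] using this
    have h2 : (Finset.univ.filter (fun t => v - t ∈ L)).card = L.card := by
      apply Finset.card_bij (fun t _ => v - t)
      · intro t ht; simpa using ht
      · intro a _ b _ hab; simpa using hab
      · intro b hb; exact ⟨v - b, by simpa using hb, by simp⟩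
    have h3 : (Finset.univ.filter (fun t => v - t ∈ L)).card +
      (Finset.univ.filter (fun t => ¬ (v - t ∈ L))).card = Fintype.card V := by
      rw [Finset.card_filter_add_card_filter_not]; rfl
    have h4 : ∀ t, (if v - t ∈ L then ({c (v - t) t}ᶜ : Finset R) else Finset.univ).card =
      if v - t ∈ L then Fintype.card R - 1 else Fintype.card R := by
      intro t; split_ifs <;> simp [Finset.card_compl]
    rw [h1, Fintype.card_piFinset, Finset.prod_congr rfl (fun t _ => h4 t), Finset.prod_ite,
      Finset.prod_const, Finset.prod_const, Fintype.card_fun, ← h3, h2, pow_add]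
    ring
  have hsum : (Finset.univ.filter (fun p : (V → R) × V => ∀ d ∈ L, p.1 (p.2 - d) ≠ c d (p.2 - d))).card
      = ∑ v : V, (Finset.univ.filter (fun h : V → R => ∀ d ∈ L, h (v - d) ≠ c d (v - d))).card := by
    simp only [Finset.card_filter]
    rw [Fintype.sum_prod_type_right]
  rw [hsum, Finset.sum_mul, Finset.sum_congr rfl (fun v _ => hfib v)]
  simp [Fintype.card_prod]
  apply le_of_eq; ring

abbrev VV (D : ℕ → Finset ℕ) (N : ℕ → ℕ) (n : ℕ) : Type :=
  (i : Fin (N n)) → (D (Nat.pair n i)) → ZMod 2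

abbrev HH (D : ℕ → Finset ℕ) (N : ℕ → ℕ) (n : ℕ) : Type :=
  (VV D N n → (Fin n → ZMod 2)) × VV D N n

def dataHom (D : ℕ → Finset ℕ) (N : ℕ → ℕ) (n : ℕ) : Cantor →+ VV D N n :=
  AddMonoidHom.mk' (fun x _ j => x j) (by intro a b; rfl)

def blockHom (D : ℕ → Finset ℕ) (N : ℕ → ℕ) (σ : (Σ n, VV D N n × Fin n) → ℕ) (n : ℕ) :
    Cantor →+ HH D N n :=
  AddMonoidHom.mk' (fun x => (fun v j => x (σ ⟨n, v, j⟩), dataHom D N n x))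
    (by intro a b; rw [map_add]; rfl)

theorem blockHom_cont (D : ℕ → Finset ℕ) (N : ℕ → ℕ) (σ : (Σ n, VV D N n × Fin n) → ℕ) (n : ℕ) :
    Continuous (blockHom D N σ n) := by
  have : Continuous (fun x : Cantor => ((fun v j => x (σ ⟨n, v, j⟩), fun _ j => x j) : HH D N n)) := by
    fun_prop
  exact this

theorem blockHom_surj (D : ℕ → Finset ℕ) (N : ℕ → ℕ) (σ : (Σ n, VV D N n × Fin n) → ℕ)
    (hσ : Function.Injective σ) (hDσ : ∀ k m, σ m ∉ D k)
    (hD : ∀ k k' j, j ∈ D k → j ∈ D k' → k = k') (c : ∀ n, HH D N n) :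
    ∃ x, ∀ n, blockHom D N σ n x = c n := by
  classical
  let g : (Σ n, VV D N n × Fin n) ⊕ (Σ n, Σ i : Fin (N n), D (Nat.pair n i)) → ℕ :=
    Sum.elim σ (fun q => q.2.2.1)
  have hg : Function.Injective g := by
    apply Function.Injective.sumElim hσ
    · rintro ⟨n, i, j, hj⟩ ⟨n', i', j', hj'⟩ h
      simp only at h
      subst h
      have h1 := hD _ _ _ hj hj'
      rw [Nat.pair_eq_pair] at h1
      obtain ⟨rfl, h2⟩ := h1
      obtain rfl := Fin.ext h2
      rfl
    · rintro m ⟨n, i, j, hj⟩ h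
      simp only at h
      exact hDσ _ m (h ▸ hj)
  let v : (Σ n, VV D N n × Fin n) ⊕ (Σ n, Σ i : Fin (N n), D (Nat.pair n i)) → ZMod 2 :=
    Sum.elim (fun q => (c q.1).1 q.2.1 q.2.2) (fun q => (c q.1).2 q.2.1 q.2.2)
  refine ⟨Function.extend g v 0, fun n => ?_⟩
  apply Prod.ext
  · funext w j
    exact hg.extend_apply v 0 (Sum.inl ⟨n, w, j⟩)
  · funext i j
    exact hg.extend_apply v 0 (Sum.inr ⟨n, i, j⟩)

theorem exists_k (n : ℕ) : ∃ k : ℕ, (2 ^ n - 1) ^ k * 2 ≤ (2 ^ n) ^ k := by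
  have hp : (0 : ℝ) < 2 ^ n := by positivity
  obtain ⟨k, hk⟩ := exists_pow_lt_of_lt_one (show (0 : ℝ) < 1 / 2 by norm_num)
    (show ((2 : ℝ) ^ n - 1) / 2 ^ n < 1 by rw [div_lt_one hp]; linarith)
  refine ⟨k, ?_⟩
  rw [div_pow, div_lt_iff₀ (by positivity)] at hk
  have h1 : 1 ≤ 2 ^ n := Nat.one_le_two_pow
  have : (((2 ^ n - 1) ^ k * 2 : ℕ) : ℝ) ≤ (((2 ^ n) ^ k : ℕ) : ℝ) := by
    push_cast [Nat.cast_sub h1]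
    linarith
  exact_mod_cast this

theorem half_measure (D : ℕ → Finset ℕ) (N : ℕ → ℕ) (σ : (Σ n, VV D N n × Fin n) → ℕ) (n k : ℕ)
    (hsurj : Function.Surjective (blockHom D N σ n))
    (hk : (2 ^ n - 1) ^ k * 2 ≤ (2 ^ n) ^ k) (Y : Set Cantor)
    (hY : k ≤ (dataHom D N n '' Y).ncard) :
    1 / 2 ≤ μC (blockHom D N σ n ⁻¹' {p | ∃ x ∈ Y, (p - blockHom D N σ n x).1
      (p - blockHom D N σ n x).2 = 0}) := by
  classical
  set S : Set (HH D N n) := {p | ∃ x ∈ Y, (p - blockHom D N σ n x).1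
      (p - blockHom D N σ n x).2 = 0} with hS
  let L : Finset (VV D N n) := (dataHom D N n '' Y).toFinset
  have hL : ∀ d ∈ L, ∃ x ∈ Y, dataHom D N n x = d := by
    intro d hd; simpa [L] using hd
  have hLk : k ≤ L.card := by rwa [Set.ncard_eq_toFinset_card'] at hY
  choose! x hxY hx using hL
  let c : VV D N n → VV D N n → (Fin n → ZMod 2) := fun d t => (blockHom D N σ n (x d)).1 t
  have hcount := count_bound L c
  have hcardR : Fintype.card (Fin n → ZMod 2) = 2 ^ n := by simp [ZMod.card]
  rw [hcardR] at hcount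
  have hsub : S.toFinsetᶜ ⊆ (Finset.univ.filter
      (fun p : HH D N n => ∀ d ∈ L, p.1 (p.2 - d) ≠ c d (p.2 - d))) := by
    intro p hp
    simp only [Finset.mem_compl, Set.mem_toFinset] at hp
    simp only [Finset.mem_filter, Finset.mem_univ, true_and]
    intro d hd heq
    apply hp
    refine ⟨x d, hxY d hd, ?_⟩
    have h2 : (blockHom D N σ n (x d)).2 = d := hx d hd
    rw [Prod.snd_sub, h2, Prod.fst_sub, Pi.sub_apply, heq, sub_self]
  have hle := Finset.card_le_card hsub
  have hpow : (2 ^ n - 1) ^ L.card * 2 ≤ (2 ^ n) ^ L.card := by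
    obtain ⟨r, hr⟩ := Nat.exists_eq_add_of_le hLk
    rw [hr, pow_add, pow_add]
    calc (2 ^ n - 1) ^ k * (2 ^ n - 1) ^ r * 2 = ((2 ^ n - 1) ^ k * 2) * (2 ^ n - 1) ^ r := by ring
      _ ≤ (2 ^ n) ^ k * (2 ^ n) ^ r := Nat.mul_le_mul hk (Nat.pow_le_pow_left (Nat.sub_le _ _) _)
  have hpos : 0 < (2 ^ n) ^ L.card := by positivity
  have hfin : S.toFinsetᶜ.card * 2 ≤ Fintype.card (HH D N n) := by
    refine Nat.le_of_mul_le_mul_right ?_ hpos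
    calc S.toFinsetᶜ.card * 2 * (2 ^ n) ^ L.card
        = (S.toFinsetᶜ.card * (2 ^ n) ^ L.card) * 2 := by ring
      _ ≤ ((2 ^ n - 1) ^ L.card * Fintype.card (HH D N n)) * 2 :=
          Nat.mul_le_mul_right _ ((Nat.mul_le_mul_right _ hle).trans hcount)
      _ = ((2 ^ n - 1) ^ L.card * 2) * Fintype.card (HH D N n) := by ring
      _ ≤ (2 ^ n) ^ L.card * Fintype.card (HH D N n) := Nat.mul_le_mul_right _ hpow
      _ = _ := by ring
  have hcompl := Finset.card_add_card_compl S.toFinset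
  have hunif := uniform_hom (blockHom D N σ n)
    (fun h => ((isClopen_discrete _).preimage (blockHom_cont D N σ n)).isOpen.measurableSet) hsurj S.toFinset
  rw [Set.coe_toFinset] at hunif
  rw [hunif, ENNReal.le_div_iff_mul_le (Or.inl (Nat.cast_ne_zero.mpr Fintype.card_ne_zero))
    (Or.inl (ENNReal.natCast_ne_top _)), ENNReal.div_eq_inv_mul, mul_one,
    ENNReal.inv_mul_le_iff (by simp) (by simp)]
  have : Fintype.card (HH D N n) ≤ 2 * S.toFinset.card := by omega
  exact_mod_cast this

theorem block_measure (D : ℕ → Finset ℕ) (N : ℕ → ℕ) (σ : (Σ n, VV D N n × Fin n) → ℕ) (n : ℕ)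
    (hsurj : Function.Surjective (blockHom D N σ n)) :
    μC (blockHom D N σ n ⁻¹' {p | p.1 p.2 = 0}) ≤ (2⁻¹ : ENNReal) ^ n := by
  classical
  let S : Set (HH D N n) := {p | p.1 p.2 = 0}
  have hunif := uniform_hom (blockHom D N σ n)
    (fun h => ((isClopen_discrete _).preimage (blockHom_cont D N σ n)).isOpen.measurableSet) hsurj S.toFinset
  rw [Set.coe_toFinset] at hunif
  rw [hunif]
  have hS : S.toFinset.card * 2 ^ n ≤ Fintype.card (HH D N n) := by
    have hinj : Function.Injective (fun q : S × (Fin n → ZMod 2) =>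
        ((q.1.1.1 + fun _ => q.2, q.1.1.2) : HH D N n)) := by
      rintro ⟨⟨⟨h, v⟩, hp⟩, r⟩ ⟨⟨⟨h', v'⟩, hp'⟩, r'⟩ heq
      simp only [Prod.mk.injEq] at heq
      obtain ⟨h1, rfl⟩ := heq
      have h2 := congrFun h1 v
      have e1 : h v = 0 := hp
      have e2 : h' v = 0 := hp'
      simp only [Pi.add_apply, e1, e2, zero_add] at h2
      subst h2
      have h3 : h = h' := by simpa using h1
      subst h3
      rfl
    have := Fintype.card_le_of_injective _ hinj
    simpa [Fintype.card_prod, ZMod.card, Set.toFinset_card] using this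
  rw [ENNReal.div_le_iff (Nat.cast_ne_zero.mpr Fintype.card_ne_zero)
    (ENNReal.natCast_ne_top _), ← ENNReal.inv_pow, mul_comm, ← div_eq_mul_inv,
    ENNReal.le_div_iff_mul_le (by simp) (by simp)]
  exact_mod_cast hS

theorem slalom (X : Set Cantor) (hX : NullAdditive X) (D : ℕ → Finset ℕ) (τ : ℕ → ℕ)
    (hτ : Function.Injective τ) (hDτ : ∀ k m, τ m ∉ D k)
    (hD : ∀ k k' j, j ∈ D k → j ∈ D k' → k = k') :
    ∃ (N : ℕ → ℕ) (s : ∀ n, Fin (N n) → VV D N n), ∀ x ∈ X, ∀ᶠ n in atTop,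
      ∃ i, s n i = dataHom D N n x := by
  classical
  choose k hk using exists_k
  let N : ℕ → ℕ := fun n => (n + 1) * k n
  obtain ⟨code, hcode⟩ := exists_injective_nat (Σ n, VV D N n × Fin n)
  let σ := τ ∘ code
  have hall := blockHom_surj D N σ (hτ.comp hcode) (fun k m => hDτ k _) hD
  have hsurj : ∀ n, Function.Surjective (blockHom D N σ n) := by
    intro n h
    obtain ⟨x, hx⟩ := hall (Function.update 0 n h)
    exact ⟨x, by simp [hx]⟩
  have hclop : ∀ n (S : Set (HH D N n)), IsClopen (blockHom D N σ n ⁻¹' S) :=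
    fun n S => (isClopen_discrete _).preimage (blockHom_cont D N σ n)
  obtain ⟨P, m, hP, hcov⟩ := covering X hX
    (fun n => blockHom D N σ n ⁻¹' {p | p.1 p.2 = 0}) (fun n => hclop n _) (by
      refine ne_top_of_le_ne_top ?_ (ENNReal.tsum_le_tsum fun n => block_measure D N σ n (hsurj n))
      rw [ENNReal.tsum_geometric]
      simp)
  let Y : ℕ → Set Cantor := fun i => {x ∈ X | ∀ z ∈ P i, ∀ n ≥ m i,
    z - x ∉ blockHom D N σ n ⁻¹' {p | p.1 p.2 = 0}}
  have hev : ∀ i, ∀ᶠ n in atTop, (dataHom D N n '' Y i).ncard < k n := by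
    intro i
    by_contra hcon
    rw [not_eventually] at hcon
    let S : ∀ n, Set (HH D N n) := fun n => {p | ∃ x ∈ Y i, (p - blockHom D N σ n x).1
      (p - blockHom D N σ n x).2 = 0}
    have hind := indep_hom (blockHom D N σ) (fun n S => (hclop n S).isOpen.measurableSet) hall S
    have hfreq : ∃ᶠ n in atTop, 1 / 2 ≤ μC (blockHom D N σ n ⁻¹' S n) :=
      hcon.mono fun n hn => half_measure D N σ n (k n) (hsurj n) (hk n) (Y i) (not_lt.mp hn)
    have htop : ∑' n, μC (blockHom D N σ n ⁻¹' S n) = ⊤ := by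
      by_contra hne
      have ht := ENNReal.tendsto_atTop_zero_of_tsum_ne_top hne
      have : ∀ᶠ n in atTop, μC (blockHom D N σ n ⁻¹' S n) < 1 / 2 :=
        ht.eventually_lt_const (by simp)
      obtain ⟨n, h1, h2⟩ := (hfreq.and_eventually this).exists
      exact absurd h1 (not_le.mpr h2)
    have hone := measure_limsup_eq_one (fun n => (hclop n (S n)).isOpen.measurableSet) hind htop
    apply hP i
    have hmeas : MeasurableSet (limsup (fun n => blockHom D N σ n ⁻¹' S n) atTop) :=
      MeasurableSet.measurableSet_limsup fun n => (hclop n (S n)).isOpen.measurableSet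
    refine measure_mono_null ?_ ((prob_compl_eq_zero_iff hmeas).mpr hone)
    intro z hz hlim
    rw [limsup_eq_iInf_iSup_of_nat] at hlim
    simp only [Set.iInf_eq_iInter, Set.iSup_eq_iUnion, Set.mem_iInter, Set.mem_iUnion] at hlim
    obtain ⟨n, hn, x, hx, hzx⟩ := hlim (m i)
    apply hx.2 z hz n hn
    rw [Set.mem_preimage, map_sub]
    exact hzx
  let I : ∀ n, Finset (VV D N n) := fun n => (Finset.range (n + 1)).biUnion fun i =>
    if (dataHom D N n '' Y i).ncard < k n then (dataHom D N n '' Y i).toFinset else ∅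
  have hI : ∀ n, (I n).card ≤ N n := by
    intro n
    refine (Finset.card_biUnion_le_card_mul _ _ (k n) ?_).trans (by simp [N])
    intro i _
    split_ifs with h
    · rw [Set.ncard_eq_toFinset_card'] at h
      exact h.le
    · simp
  refine ⟨N, fun n i => if h : i.1 < (I n).card then ((I n).equivFin.symm ⟨i, h⟩).1 else 0, ?_⟩
  intro x hx
  obtain ⟨i, hi⟩ := hcov x hx
  filter_upwards [hev i, eventually_ge_atTop i] with n hn hin
  have hmem : dataHom D N n x ∈ I n := by
    simp only [I, Finset.mem_biUnion, Finset.mem_range]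
    refine ⟨i, by omega, ?_⟩
    rw [if_pos hn, Set.mem_toFinset]
    exact ⟨x, ⟨hx, hi⟩, rfl⟩
  let q := (I n).equivFin ⟨_, hmem⟩
  refine ⟨⟨q.1, q.2.trans_le (hI n)⟩, ?_⟩
  rw [dif_pos q.2]
  simp [q]

/-- Every null-additive subset of Cantor space is meager-additive. -/
theorem stmt0 (X : Set Cantor) (h : NullAdditive X) : MeagerAdditive X := by
  classical
  intro A hA
  obtain ⟨f, a, hf, hfa⟩ := meagre_guess A hA
  let D : ℕ → Finset ℕ := fun k => Finset.Ico (f (2 * k)) (f (2 * k + 1))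
  have hD : ∀ k k' j, j ∈ D k → j ∈ D k' → k = k' := by
    intro k k' j h1 h2
    simp only [D, Finset.mem_Ico] at h1 h2
    have h3 := hf.lt_iff_lt.mp (h1.1.trans_lt h2.2)
    have h4 := hf.lt_iff_lt.mp (h2.1.trans_lt h1.2)
    omega
  obtain ⟨N, s, hs⟩ := slalom X h D (fun k => f (2 * k + 1))
    (fun a b hab => by have := hf.injective hab; omega)
    (by
      intro k m hm
      simp only [D, Finset.mem_Ico] at hm
      have h3 := hf.le_iff_le.mp hm.1
      have h4 := hf.lt_iff_lt.mp hm.2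
      omega) hD
  let g : (Σ n, Σ i : Fin (N n), D (Nat.pair n i)) → ℕ := fun q => q.2.2.1
  have hg : Function.Injective g := by
    rintro ⟨n, i, j, hj⟩ ⟨n', i', j', hj'⟩ h
    simp only [g] at h
    subst h
    have h1 := hD _ _ _ hj hj'
    rw [Nat.pair_eq_pair] at h1
    obtain ⟨rfl, h2⟩ := h1
    obtain rfl := Fin.ext h2
    rfl
  let y : Cantor := Function.extend g (fun q => s q.1 q.2.1 q.2.1 q.2.2 + a q.2.2.1) 0
  have hy : ∀ n (i : Fin (N n)) (j : D (Nat.pair n i)), y j = s n i i j + a j := by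
    intro n i j
    exact hg.extend_apply _ _ ⟨n, i, j⟩
  let E : ℕ → Finset ℕ := fun n => Finset.univ.biUnion fun i : Fin (N n) => D (Nat.pair n i)
  refine (meagre_of_avoid E ?_ y).mono ?_
  · intro n
    refine ⟨n, fun k hk j hj => ?_⟩
    simp only [E, Finset.mem_biUnion, Finset.mem_univ, true_and, D, Finset.mem_Ico] at hj
    obtain ⟨i, h1, -⟩ := hj
    have h2 := hf.id_le (2 * Nat.pair k i)
    have h3 := Nat.left_le_pair k i
    simp only [id] at h2
    omega
  · rintro w ⟨x, hx, z, hz, rfl⟩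
    obtain ⟨m, hm⟩ := eventually_atTop.mp (hfa z hz)
    simp only [Set.mem_ofPred_eq]
    filter_upwards [hs x hx, eventually_ge_atTop m] with n hn hmn
    obtain ⟨i, hi⟩ := hn
    have h3 := Nat.left_le_pair n i
    obtain ⟨j, hj1, hj2, hj⟩ := hm (2 * Nat.pair n i) (by omega)
    have hjD : j ∈ D (Nat.pair n i) := by
      simp only [D, Finset.mem_Ico]; exact ⟨hj1, hj2⟩
    refine ⟨j, ?_, ?_⟩
    · simp only [E, Finset.mem_biUnion, Finset.mem_univ, true_and]
      exact ⟨i, hjD⟩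
    · have h1 := hy n i ⟨j, hjD⟩
      simp only at h1
      rw [h1, hi]
      intro heq
      apply hj
      have h2 : x j + z j = x j + a j := heq
      exact add_left_cancel h2
end

section
/- A set X ⊆ 2^ω is null-additive if and only if for every corset f there are trees S_m (m < ω), each of width f, such that X ⊆ ⋃_{m<ω} Lim S_m. -/
open MeasureTheory Pointwise

instance : IsTopologicalAddGroup (ZMod 2) where
  continuous_add := continuous_of_discreteTopology
  continuous_neg := continuous_of_discreteTopology
instance : IsProbabilityMeasure μC := ⟨by
  have := Measure.addHaarMeasure_self (K₀ := (⊤ : TopologicalSpace.PositiveCompacts Cantor))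
  simpa [μC] using this⟩
instance : μC.IsAddHaarMeasure := by unfold μC; infer_instance
instance : μC.Regular := by unfold μC; infer_instance

lemma corset_exists (a : ℕ → ENNReal) (ha : ∑' n, a n ≠ ⊤) :
    ∃ f : ℕ → ℕ, Corset f ∧ ∑' n, (f n : ENNReal) * a n ≠ ⊤ := by
  classical
  have htail : ∀ k : ℕ, ∃ N : ℕ, ∑' n, (if N ≤ n then a n else 0) ≤ (1/2 : ENNReal) ^ k := by
    intro k
    have h := ENNReal.tendsto_sum_nat_add a ha
    have hpos : (0 : ENNReal) < (1/2 : ENNReal) ^ k := by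
      apply ENNReal.pow_pos; simp
    obtain ⟨N, hN⟩ := (h.eventually (gt_mem_nhds hpos)).exists
    refine ⟨N, le_trans (le_of_eq ?_) hN.le⟩
    rw [← ENNReal.summable.sum_add_tsum_nat_add' (f := fun n => if N ≤ n then a n else 0) (k := N)]
    rw [Finset.sum_eq_zero, zero_add]
    · simp
    · intro i hi
      have : ¬ N ≤ i := by simpa using hi
      simp [this]
  choose N hN using htail
  refine ⟨fun n => 1 + ((Finset.range n).filter (fun k => N k ≤ n)).card, ⟨?_, ?_, ?_⟩, ?_⟩
  · intro m n hmn
    have : ((Finset.range m).filter (fun k => N k ≤ m)) ⊆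
        ((Finset.range n).filter (fun k => N k ≤ n)) := by
      intro k; simp; omega
    have := Finset.card_le_card this
    simp only; omega
  · intro n; exact Nat.add_pos_left one_pos _
  · refine Filter.tendsto_atTop.2 fun b => ?_
    filter_upwards [Filter.eventually_ge_atTop b,
      (Finset.range b).eventually_all.2 (fun k _ => Filter.eventually_ge_atTop (N k))] with n hn hk
    have : Finset.range b ⊆ (Finset.range n).filter (fun k => N k ≤ n) := by
      intro k hkb
      have := hk k hkb
      simp at hkb ⊢; omega
    have := Finset.card_le_card this
    simp at this; omega
  · have : ∀ n, ((1 + ((Finset.range n).filter (fun k => N k ≤ n)).card : ℕ) : ENNReal) * a n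
        ≤ a n + ∑' k, (if N k ≤ n then a n else 0) := by
      intro n
      push_cast
      rw [add_mul, one_mul]
      gcongr
      calc _ = ∑ k ∈ Finset.range n, (if N k ≤ n then a n else 0) := by
            rw [← Finset.sum_filter]; simp
        _ ≤ _ := ENNReal.sum_le_tsum _
    refine ne_top_of_le_ne_top ?_ (ENNReal.tsum_le_tsum this)
    rw [ENNReal.tsum_add, ENNReal.tsum_comm]
    refine ENNReal.add_ne_top.2 ⟨ha, ne_top_of_le_ne_top ?_ (ENNReal.tsum_le_tsum hN)⟩
    rw [ENNReal.tsum_geometric]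
    simp

def cyl (x : Cantor) (n : ℕ) : Set Cantor := {y | ∀ i < n, y i = x i}

lemma isOpen_cyl (x : Cantor) (n : ℕ) : IsOpen (cyl x n) := by
  have : cyl x n = ⋂ i ∈ Finset.range n, (fun y : Cantor => y i) ⁻¹' {x i} := by
    ext y; simp [cyl]
  rw [this]
  exact isOpen_biInter_finset fun i _ => (isOpen_discrete _).preimage (continuous_apply i)

lemma mem_cyl (x : Cantor) (n : ℕ) : x ∈ cyl x n := fun _ _ => rfl

lemma cyl_anti (x : Cantor) {m n : ℕ} (h : m ≤ n) : cyl x n ⊆ cyl x m :=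
  fun _ hy i hi => hy i (hi.trans_le h)

lemma cyl_eq {x y : Cantor} {n : ℕ} (h : y ∈ cyl x n) : cyl y n = cyl x n := by
  ext z
  exact ⟨fun hz i hi => (hz i hi).trans (h i hi), fun hz i hi => (hz i hi).trans (h i hi).symm⟩

lemma exists_cyl {U : Set Cantor} (hU : IsOpen U) {x : Cantor} (hx : x ∈ U) :
    ∃ n, cyl x n ⊆ U := by
  obtain ⟨I, u, hu, hsub⟩ := isOpen_pi_iff.1 hU x hx
  refine ⟨I.sup id + 1, fun y hy => hsub ?_⟩
  intro i hi
  have : i < I.sup id + 1 := Nat.lt_succ_of_le (Finset.le_sup (f := id) hi)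
  rw [hy i this]
  exact (hu i hi).2

/-- `n` is the least length at which the cylinder of `x` is inside `U`. -/
def firstIn (U : Set Cantor) (n : ℕ) : Set Cantor :=
  {x | cyl x n ⊆ U ∧ ∀ i < n, ¬ cyl x i ⊆ U}

lemma firstIn_inv {U : Set Cantor} {n : ℕ} {x y : Cantor} (hx : x ∈ firstIn U n)
    (hy : y ∈ cyl x n) : y ∈ firstIn U n := by
  refine ⟨by rw [cyl_eq hy]; exact hx.1, fun i hi => ?_⟩
  rw [cyl_eq (cyl_anti x hi.le hy)]
  exact hx.2 i hi

lemma isOpen_firstIn (U : Set Cantor) (n : ℕ) : IsOpen (firstIn U n) := by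
  rw [isOpen_iff_forall_mem_open]
  exact fun x hx => ⟨cyl x n, fun y hy => firstIn_inv hx hy, isOpen_cyl x n, mem_cyl x n⟩

lemma tsum_firstIn (U : Set Cantor) : ∑' n, μC (firstIn U n) ≤ μC U := by
  rw [← measure_iUnion]
  · refine measure_mono (Set.iUnion_subset fun n x hx => hx.1 (mem_cyl x n))
  · intro m n hmn
    rw [Function.onFun, Set.disjoint_left]
    intro x hm hn
    rcases lt_or_gt_of_ne hmn with h | h
    · exact hn.2 m h hm.1
    · exact hm.2 n h hn.1
  · exact fun n => (isOpen_firstIn U n).measurableSet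

lemma exists_firstIn {U : Set Cantor} (hU : IsOpen U) {x : Cantor} (hx : x ∈ U) :
    ∃ n, x ∈ firstIn U n := by
  classical
  have h := exists_cyl hU hx
  exact ⟨Nat.find h, Nat.find_spec h, fun i hi => Nat.find_min h hi⟩

/-- Pad a finite sequence by zeros. -/
def pad (σ : FinSeq) : Cantor := fun i => σ.getD i 0

lemma pad_res (x : Cantor) (n i : ℕ) (hi : i < n) : pad (res x n) i = x i := by
  simp [pad, res, hi]

lemma res_length (x : Cantor) (n : ℕ) : (res x n).length = n := by simp [res]

lemma finite_length (n : ℕ) : {τ : FinSeq | τ.length = n}.Finite := List.finite_length_eq _ n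

theorem backward (X : Set Cantor) (H : ∀ f : ℕ → ℕ, Corset f → ∃ S : ℕ → Set FinSeq,
        (∀ m, IsTree (S m) ∧ widthLe (S m) f) ∧ X ⊆ ⋃ m, LimT (S m)) : NullAdditive X := by
  classical
  intro A hA
  have hopen : ∀ k : ℕ, ∃ U, A ⊆ U ∧ IsOpen U ∧ μC U < (1/2 : ENNReal) ^ k := by
    intro k
    refine Set.exists_isOpen_lt_of_lt A _ ?_
    rw [hA]; apply ENNReal.pow_pos; simp
  choose U hAU hUo hUm using hopen
  let D : ℕ → Set Cantor := fun n => ⋃ k, firstIn (U k) n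
  have hDinv : ∀ n x y, x ∈ D n → y ∈ cyl x n → y ∈ D n := by
    intro n x y hx hy
    obtain ⟨k, hk⟩ := Set.mem_iUnion.1 hx
    exact Set.mem_iUnion.2 ⟨k, firstIn_inv hk hy⟩
  have hDsum : ∑' n, μC (D n) ≠ ⊤ := by
    have h1 : ∑' n, μC (D n) ≤ ∑' n, ∑' k, μC (firstIn (U k) n) :=
      ENNReal.tsum_le_tsum fun n => measure_iUnion_le _
    rw [ENNReal.tsum_comm] at h1
    have h2 : ∑' k, ∑' n, μC (firstIn (U k) n) ≤ ∑' k, (1/2 : ENNReal) ^ k :=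
      ENNReal.tsum_le_tsum fun k => (tsum_firstIn _).trans (hUm k).le
    refine ne_top_of_le_ne_top ?_ (h1.trans h2)
    rw [ENNReal.tsum_geometric]; simp
  have hDinf : ∀ x ∈ A, ∃ᶠ n in Filter.atTop, x ∈ D n := by
    intro x hx
    rw [Filter.frequently_atTop]
    intro b
    by_contra hcon
    push Not at hcon
    have hsub : ∀ k, cyl x b ⊆ U k := by
      intro k
      obtain ⟨n, hn⟩ := exists_firstIn (hUo k) (hAU k hx)
      have hnb : n < b := by
        by_contra h
        exact hcon n (not_lt.1 h) (Set.mem_iUnion.2 ⟨k, hn⟩)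
      exact (cyl_anti x hnb.le).trans hn.1
    have hpos : 0 < μC (cyl x b) := (isOpen_cyl x b).measure_pos μC ⟨x, mem_cyl x b⟩
    have ht : Filter.Tendsto (fun k : ℕ => (1/2 : ENNReal) ^ k) Filter.atTop (nhds 0) :=
      ENNReal.tendsto_pow_atTop_nhds_zero_of_lt_one (by simp)
    obtain ⟨k, hk⟩ := (ht.eventually (gt_mem_nhds hpos)).exists
    exact absurd ((measure_mono (hsub k)).trans (hUm k).le) (not_le.2 hk)
  obtain ⟨f, hf, hfs⟩ := corset_exists _ hDsum
  obtain ⟨S, hS, hXS⟩ := H f hf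
  have hone : ∀ m, μC (LimT (S m) + A) = 0 := by
    intro m
    have hfin : ∀ n, {τ ∈ S m | τ.length = n}.Finite := fun n =>
      (finite_length n).subset fun τ h => h.2
    let E : ℕ → Set Cantor := fun n => ⋃ τ ∈ (hfin n).toFinset, (fun y => - pad τ + y) ⁻¹' D n
    have hE : ∀ n, μC (E n) ≤ f n * μC (D n) := by
      intro n
      calc μC (E n) ≤ ∑ τ ∈ (hfin n).toFinset, μC ((fun y => - pad τ + y) ⁻¹' D n) :=
            measure_biUnion_finset_le _ _
        _ = ((hfin n).toFinset.card : ENNReal) * μC (D n) := by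
            simp [measure_preimage_add]
        _ ≤ _ := by
            gcongr
            rw [← Set.ncard_eq_toFinset_card _ (hfin n)]
            exact (hS m).2 n
    have h0 : μC (Filter.limsup E Filter.atTop) = 0 :=
      measure_limsup_atTop_eq_zero (ne_top_of_le_ne_top hfs (ENNReal.tsum_le_tsum hE))
    refine measure_mono_null ?_ h0
    rintro y ⟨x, hx, z, hz, rfl⟩
    rw [Filter.mem_limsup_iff_frequently_mem]
    refine (hDinf z hz).mono fun n hn => ?_
    simp only [E, Set.mem_iUnion]
    refine ⟨res x n, by simp [res_length]; exact hx n, ?_⟩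
    refine hDinv n z _ hn fun i hi => ?_
    show - pad (res x n) i + (x i + z i) = z i
    rw [pad_res x n i hi, neg_add_cancel_left]
  refine measure_mono_null ?_ (measure_iUnion_null hone)
  rintro y ⟨x, hx, z, hz, rfl⟩
  obtain ⟨m, hm⟩ := Set.mem_iUnion.1 (hXS hx)
  exact Set.mem_iUnion.2 ⟨m, Set.add_mem_add hm hz⟩

/-- second moment -/
lemma second_moment {G : Type*} [AddCommGroup G] [Fintype G] [DecidableEq G] (A B : Finset G) (k N : ℕ)
    (hk : 0 < k) (hN : 0 < N) (hB : B.card = k) (hA1 : N ≤ k * A.card) (hA2 : k * A.card ≤ 2 * N)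
    (hP : ∀ c : G, c ≠ 0 → k ^ 2 * (A.filter (fun a => a + c ∈ A)).card ≤ 2 * N) :
    N ≤ 4 * (A + B).card := by
  classical
  -- number of representations of y as a + b
  let r : G → ℕ := fun y => (B.filter (fun b => y - b ∈ A)).card
  have hr0 : ∀ y, y ∉ A + B → r y = 0 := by
    intro y hy
    simp only [r, Finset.card_eq_zero, Finset.filter_eq_empty_iff]
    intro b hb h
    exact hy (Finset.mem_add.2 ⟨y - b, h, b, hb, by abel⟩)
  have htr : ∀ b : G, (Finset.univ.filter (fun y => y - b ∈ A)).card = A.card := by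
    intro b
    rw [← Finset.card_image_of_injective A (add_left_injective b)]
    congr 1
    ext y
    simp only [Finset.mem_filter, Finset.mem_univ, true_and, Finset.mem_image]
    constructor
    · intro h; exact ⟨_, h, by abel⟩
    · rintro ⟨a, ha, rfl⟩; simpa using ha
  have hS1 : ∑ y, r y = k * A.card := by
    simp only [r, Finset.card_filter]
    rw [Finset.sum_comm]
    simp only [← Finset.card_filter]
    simp [htr, hB]
  have hpair : ∀ b b' : G, b ≠ b' →
      k ^ 2 * (Finset.univ.filter (fun y => y - b ∈ A ∧ y - b' ∈ A)).card ≤ 2 * N := by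
    intro b b' hbb
    refine le_trans (Nat.mul_le_mul_left _ ?_) (hP (b - b') (sub_ne_zero.2 hbb))
    refine Finset.card_le_card_of_injOn (fun y => y - b) ?_ ?_
    · intro y hy
      simp only [Finset.coe_filter, Finset.mem_univ, true_and, Set.mem_ofPred_eq] at hy ⊢
      refine ⟨hy.1, ?_⟩
      convert hy.2 using 1; abel
    · intro y _ z _ h; simpa using h
  have hS2 : ∑ y, (r y) ^ 2 =
      ∑ b ∈ B, ∑ b' ∈ B, (Finset.univ.filter (fun y => y - b ∈ A ∧ y - b' ∈ A)).card := by
    simp only [r, Finset.card_filter, sq, Finset.sum_mul_sum]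
    rw [Finset.sum_comm]
    refine Finset.sum_congr rfl fun b _ => ?_
    rw [Finset.sum_comm]
    refine Finset.sum_congr rfl fun b' _ => ?_
    refine Finset.sum_congr rfl fun y _ => ?_
    by_cases h1 : y - b ∈ A <;> by_cases h2 : y - b' ∈ A <;> simp [h1, h2]
  have hS2' : ∑ y, (r y) ^ 2 ≤ 4 * N := by
    have : k ^ 2 * ∑ y, (r y) ^ 2 ≤ k ^ 2 * (4 * N) := by
      rw [hS2, Finset.mul_sum]
      calc ∑ b ∈ B, k ^ 2 * ∑ b' ∈ B, (Finset.univ.filter (fun y => y - b ∈ A ∧ y - b' ∈ A)).card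
          ≤ ∑ b ∈ B, (k ^ 2 * A.card + k * (2 * N)) := by
            refine Finset.sum_le_sum fun b hb => ?_
            rw [← Finset.add_sum_erase B _ hb, mul_add]
            gcongr ?_ + ?_
            · simp [htr]
            · rw [Finset.mul_sum]
              refine (Finset.sum_le_card_nsmul _ _ (2 * N) fun b' hb' => ?_).trans ?_
              · exact hpair b b' (Finset.ne_of_mem_erase hb').symm
              · rw [smul_eq_mul]
                gcongr
                rw [← hB]; exact Finset.card_erase_le
        _ = k ^ 2 * (k * A.card + 2 * N) := by rw [Finset.sum_const, hB, smul_eq_mul]; ring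
        _ ≤ k ^ 2 * (4 * N) := by gcongr; omega
    exact Nat.le_of_mul_le_mul_left this (by positivity)
  have hsub : ∑ y ∈ A + B, r y = ∑ y, r y :=
    Finset.sum_subset (Finset.subset_univ _) fun y _ hy => hr0 y hy
  have hCS : (∑ y ∈ A + B, r y) ^ 2 ≤ (A + B).card * ∑ y ∈ A + B, (r y) ^ 2 :=
    sq_sum_le_card_mul_sum_sq
  have hle : ∑ y ∈ A + B, (r y) ^ 2 ≤ ∑ y, (r y) ^ 2 :=
    Finset.sum_le_sum_of_subset (Finset.subset_univ _)
  rw [hsub, hS1] at hCS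
  have : N * N ≤ N * (4 * (A + B).card) := by
    calc N * N ≤ (k * A.card) ^ 2 := by rw [sq]; gcongr
      _ ≤ (A + B).card * (4 * N) := hCS.trans (by gcongr; exact hle.trans hS2')
      _ = _ := by ring
  exact Nat.le_of_mul_le_mul_left this hN

/-- fibres of surjective homs -/
lemma fiber_card {V W : Type*} [AddCommGroup V] [Fintype V] [AddCommGroup W] [Fintype W]
    [DecidableEq W] (T : V →+ W) (hT : Function.Surjective T) (w : W) :
    Fintype.card W * (Finset.univ.filter (fun v => T v = w)).card = Fintype.card V := by
  classical
  have h := Finset.card_eq_sum_card_fiberwise (f := T) (s := Finset.univ) (t := Finset.univ)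
    (fun _ _ => by simp)
  rw [Finset.card_univ] at h
  rw [h, Finset.sum_congr rfl (fun u _ => ?_), Finset.sum_const, Finset.card_univ, smul_eq_mul]
  exact AddMonoidHom.card_fiber_eq_of_mem_range T (hT u) (hT w)

set_option linter.unusedSectionVars false
section dot
variable {K : Type*} [Field K] [Fintype K] [DecidableEq K] {M : ℕ}

def dotHom (x : Fin M → K) : (Fin M → K) →+ K where
  toFun y := x ⬝ᵥ y
  map_zero' := by simp
  map_add' := by intro a b; simp [dotProduct_add]

lemma dot_one (x : Fin M → K) (hx : x ≠ 0) :
    Fintype.card K * (Finset.univ.filter (fun y => x ⬝ᵥ y = 0)).card = Fintype.card K ^ M := by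
  have := fiber_card (dotHom x) ?_ 0
  · rw [Fintype.card_fun, Fintype.card_fin] at this
    exact this
  · obtain ⟨i, hi⟩ := Function.ne_iff.1 hx
    intro w
    refine ⟨Pi.single i (w / x i), ?_⟩
    have hi : x i ≠ 0 := hi
    simp [dotHom]; field_simp

lemma dot_two (x a : Fin M → K) (ha : a ≠ 0) (hx : ∀ c : K, x ≠ c • a) (t : K) :
    Fintype.card K ^ 2 * (Finset.univ.filter (fun y => x ⬝ᵥ y = 0 ∧ a ⬝ᵥ y = t)).card
      = Fintype.card K ^ M := by
  have := fiber_card ((dotHom x).prod (dotHom a)) ?_ (0, t)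
  · rw [Fintype.card_fun, Fintype.card_fin, Fintype.card_prod, ← sq] at this
    rw [← this]
    congr 2
    ext y
    simp [dotHom]
  · obtain ⟨i, hi⟩ := Function.ne_iff.1 ha
    have hi : a i ≠ 0 := hi
    obtain ⟨l, hl⟩ := Function.ne_iff.1 (hx (x i / a i))
    have hl : x l * a i - x i * a l ≠ 0 := by
      intro h
      apply hl
      simp; field_simp; linear_combination h
    rintro ⟨u, v⟩
    refine ⟨Pi.single i ((x l * v - a l * u) / (x l * a i - x i * a l)) +
      Pi.single l ((a i * u - x i * v) / (x l * a i - x i * a l)), ?_⟩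
    simp only [dotHom, AddMonoidHom.prod_apply, AddMonoidHom.coe_mk, ZeroHom.coe_mk,
      dotProduct_add, dotProduct_single, Prod.mk.injEq]
    constructor
    · rw [mul_div_assoc', mul_div_assoc', ← add_div, div_eq_iff hl]; ring
    · rw [mul_div_assoc', mul_div_assoc', ← add_div, div_eq_iff hl]; ring

lemma card_pairs (p : (Fin M → K) → (Fin M → K) → Prop) [∀ x y, Decidable (p x y)] :
    (Finset.univ.filter (fun z : (Fin M → K) × (Fin M → K) => p z.1 z.2)).card
      = ∑ x, (Finset.univ.filter (fun y => p x y)).card := by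
  simp only [Finset.card_filter]
  rw [← Finset.univ_product_univ, Finset.sum_product]

/-- The count for a shift with nonzero first component. -/
lemma pair_count (a : Fin M → K) (b : Fin M → K) (ha : a ≠ 0) :
    Fintype.card K ^ 2 * (Finset.univ.filter (fun z : (Fin M → K) × (Fin M → K) =>
      z.1 ⬝ᵥ z.2 = 0 ∧ (z.1 + a) ⬝ᵥ (z.2 + b) = 0)).card
      ≤ Fintype.card K ^ (2 * M) + Fintype.card K ^ (M + 3) := by
  have hcp : (Finset.univ.filter (fun z : (Fin M → K) × (Fin M → K) =>
      z.1 ⬝ᵥ z.2 = 0 ∧ (z.1 + a) ⬝ᵥ (z.2 + b) = 0)).card = ∑ x : Fin M → K,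
      (Finset.univ.filter (fun y => x ⬝ᵥ y = 0 ∧ (x + a) ⬝ᵥ (y + b) = 0)).card :=
    card_pairs (fun x y => x ⬝ᵥ y = 0 ∧ (x + a) ⬝ᵥ (y + b) = 0)
  rw [hcp, Finset.mul_sum]
  set q := Fintype.card K
  have key : ∀ x : Fin M → K,
      q ^ 2 * (Finset.univ.filter (fun y => x ⬝ᵥ y = 0 ∧ (x + a) ⬝ᵥ (y + b) = 0)).card
      ≤ q ^ M + (if x ∈ Finset.univ.image (fun c : K => c • a) then q ^ (M + 2) else 0) := by
    intro x
    split_ifs with hx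
    · calc _ ≤ q ^ 2 * q ^ M := by
            gcongr
            refine (Finset.card_le_univ _).trans ?_
            simp [q]
        _ = q ^ (M + 2) := by ring
        _ ≤ _ := by omega
    · have h2 := dot_two x a ha (fun c h => hx (by simp [h])) (-(x ⬝ᵥ b) - a ⬝ᵥ b)
      rw [← h2, add_zero]
      refine Nat.mul_le_mul_left _ (Finset.card_le_card ?_)
      intro y
      simp only [Finset.mem_filter, Finset.mem_univ, true_and]
      rintro ⟨h, h'⟩
      refine ⟨h, ?_⟩
      simp only [add_dotProduct, dotProduct_add] at h'
      linear_combination h' - h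
  refine (Finset.sum_le_sum fun x _ => key x).trans ?_
  rw [Finset.sum_add_distrib, Finset.sum_const, ← Finset.sum_filter, Finset.sum_const]
  simp only [smul_eq_mul]
  gcongr ?_ + ?_
  · simp [q, two_mul, pow_add]
  · calc _ ≤ q * q ^ (M + 2) := by
          gcongr
          rw [Finset.filter_mem_eq_inter, Finset.univ_inter]
          exact Finset.card_image_le
      _ = _ := by ring

/-- The quadric has the desired covering property. -/
lemma quadric (hM : 3 ≤ M) : ∃ A : Finset ((Fin M → K) × (Fin M → K)),
    Fintype.card K * A.card ≤ 2 * Fintype.card K ^ (2 * M) ∧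
    ∀ B : Finset ((Fin M → K) × (Fin M → K)), B.card = Fintype.card K →
      Fintype.card K ^ (2 * M) ≤ 4 * (A + B).card := by
  classical
  set q := Fintype.card K with hq
  have hq0 : 0 < q := Fintype.card_pos
  let A : Finset ((Fin M → K) × (Fin M → K)) := Finset.univ.filter (fun z => z.1 ⬝ᵥ z.2 = 0)
  have hAc : A.card = ∑ x : Fin M → K, (Finset.univ.filter (fun y => x ⬝ᵥ y = 0)).card :=
    card_pairs (fun x y => x ⬝ᵥ y = 0)
  have hlow : q ^ (2 * M) ≤ q * A.card := by
    rw [hAc, Finset.mul_sum]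
    calc q ^ (2 * M) = ∑ x : Fin M → K, q ^ M := by
          simp [q, two_mul, pow_add]
      _ ≤ _ := by
        refine Finset.sum_le_sum fun x _ => ?_
        by_cases hx : x = 0
        · subst hx; simp [← hq]
          exact Nat.le_mul_of_pos_left _ hq0
        · exact (dot_one x hx).ge
  have hup : q * A.card ≤ 2 * q ^ (2 * M) := by
    rw [hAc, Finset.mul_sum]
    calc _ ≤ ∑ x : Fin M → K, (q ^ M + if x = 0 then q ^ (M + 1) else 0) := by
          refine Finset.sum_le_sum fun x _ => ?_
          by_cases hx : x = 0
          · subst hx; simp [← hq]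
            rw [pow_succ' q M]; omega
          · simp [hx]; exact (dot_one x hx).le
      _ = q ^ (2 * M) + q ^ (M + 1) := by
          rw [Finset.sum_add_distrib]; simp [q, two_mul, pow_add]
      _ ≤ q ^ (2 * M) + q ^ (2 * M) := by
          refine Nat.add_le_add_left ?_ _
          exact Nat.pow_le_pow_right hq0 (by omega)
      _ = _ := by ring
  refine ⟨A, hup, fun B hB => ?_⟩
  refine second_moment A B q (q ^ (2 * M)) hq0 (by positivity) hB hlow hup ?_
  rintro ⟨a, b⟩ hc
  have hfin : q ^ (2 * M) + q ^ (M + 3) ≤ 2 * q ^ (2 * M) := by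
    have : q ^ (M + 3) ≤ q ^ (2 * M) := Nat.pow_le_pow_right hq0 (by omega)
    omega
  refine le_trans ?_ hfin
  by_cases ha : a = 0
  · have hb : b ≠ 0 := by rintro rfl; exact hc (by simp [ha])
    refine le_trans (Nat.mul_le_mul_left _ ?_) (pair_count b a hb)
    refine Finset.card_le_card_of_injOn Prod.swap ?_ (Prod.swap_injective.injOn)
    rintro ⟨x, y⟩
    simp [A, dotProduct_comm, add_comm]
  · refine le_trans (Nat.mul_le_mul_left _ ?_) (pair_count a b ha)
    apply Finset.card_le_card
    rintro ⟨x, y⟩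
    simp [A]
end dot

lemma comb (j l0 : ℕ) : ∃ L, l0 ≤ L ∧ ∃ A : Finset (Fin L → ZMod 2),
    2 ^ (j + 1) * A.card ≤ 2 * 2 ^ L ∧
    ∀ B : Finset (Fin L → ZMod 2), 2 ^ (j + 1) ≤ B.card → 2 ^ L ≤ 4 * (A + B).card := by
  classical
  have : Fact (Nat.Prime 2) := ⟨Nat.prime_two⟩
  let K := GaloisField 2 (j + 1)
  let _ : Fintype K := Fintype.ofFinite K
  have hK : Fintype.card K = 2 ^ (j + 1) := by
    rw [← Nat.card_eq_fintype_card]; exact GaloisField.card 2 (j + 1) (by omega)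
  let M := l0 + 3
  let V := (Fin M → K) × (Fin M → K)
  let L := Module.finrank (ZMod 2) V
  let e : V ≃ₗ[ZMod 2] (Fin L → ZMod 2) := (Module.finBasis (ZMod 2) V).equivFun
  have hV : Fintype.card K ^ (2 * M) = 2 ^ L := by
    have := Fintype.card_congr e.toEquiv
    simp only [V, Fintype.card_prod, Fintype.card_fun, Fintype.card_fin, ZMod.card] at this
    rw [← this]; ring
  obtain ⟨A, hA1, hA2⟩ := quadric (K := K) (M := M) (by omega)
  rw [hV] at hA1 hA2
  rw [hK] at hA1 hA2
  refine ⟨L, ?_, A.map e.toEquiv.toEmbedding, by simpa using hA1, ?_⟩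
  · rw [hK, ← pow_mul] at hV
    have := Nat.pow_right_injective le_rfl hV
    have h3 : 1 * (2 * M) ≤ (j + 1) * (2 * M) := Nat.mul_le_mul_right _ (by omega)
    omega
  · intro B hB
    obtain ⟨B', hB', hB'c⟩ := Finset.exists_subset_card_eq hB
    have := hA2 (B'.map e.symm.toEquiv.toEmbedding) (by simpa using hB'c)
    refine this.trans ?_
    gcongr 4 * ?_
    refine Finset.card_le_card_of_injOn e ?_ (e.injective.injOn)
    intro z hz
    simp only [Finset.coe_add, Set.mem_add] at hz ⊢
    obtain ⟨a, ha, b, hb, rfl⟩ := hz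
    refine ⟨e a, by simpa using ha, e b, ?_, by simp⟩
    simp at hb
    obtain ⟨b', hb', rfl⟩ := hb
    simpa using hB' hb'

section blocks
variable (F L : ℕ → ℕ)

/-- The `n`th block of `x`. -/
def blk (a l : ℕ) (x : Cantor) : Fin l → ZMod 2 := fun i => x (a + i)

/-- Extension of a block by zeros. -/
def ext0 (a l : ℕ) (v : Fin l → ZMod 2) : Cantor :=
  fun i => if h : a ≤ i ∧ i < a + l then v ⟨i - a, by omega⟩ else 0

lemma blk_add (a l : ℕ) (x y : Cantor) : blk a l (x + y) = blk a l x + blk a l y := rfl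

lemma blk_ext0 (a l : ℕ) (v : Fin l → ZMod 2) : blk a l (ext0 a l v) = v := by
  funext i
  simp [blk, ext0]

lemma continuous_blk (a l : ℕ) : Continuous (blk a l) :=
  continuous_pi fun i => continuous_apply _

lemma isOpen_blk (a l : ℕ) (D : Set (Fin l → ZMod 2)) : IsOpen (blk a l ⁻¹' D) :=
  (isOpen_discrete D).preimage (continuous_blk a l)

lemma isClosed_blk (a l : ℕ) (D : Set (Fin l → ZMod 2)) : IsClosed (blk a l ⁻¹' D) :=
  (isClosed_discrete D).preimage (continuous_blk a l)

/-- Independence of a block from a set invariant under translation by that block. -/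
lemma blk_indep (a l : ℕ) (E : Set Cantor) (hE : MeasurableSet E)
    (hinv : ∀ v : Fin l → ZMod 2, ∀ x ∈ E, ext0 a l v + x ∈ E) (D : Finset (Fin l → ZMod 2)) :
    2 ^ l * μC (E ∩ blk a l ⁻¹' D) = D.card * μC E := by
  classical
  have hpiece : ∀ v, μC (E ∩ blk a l ⁻¹' {v}) = μC (E ∩ blk a l ⁻¹' {0}) := by
    intro v
    rw [← measure_preimage_add μC (ext0 a l v) (E ∩ blk a l ⁻¹' {v})]
    congr 1
    ext x
    simp only [Set.mem_preimage, Set.mem_inter_iff, Set.mem_singleton_iff, blk_add, blk_ext0,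
      add_eq_left]
    refine and_congr_left fun _ => ⟨fun h => ?_, hinv v x⟩
    have := hinv v _ h
    rwa [← add_assoc, show ext0 a l v + ext0 a l v = 0 from funext fun i => CharTwo.add_self_eq_zero _,
      zero_add] at this
  have hsum : ∀ D : Finset (Fin l → ZMod 2),
      μC (E ∩ blk a l ⁻¹' D) = D.card * μC (E ∩ blk a l ⁻¹' {0}) := by
    intro D
    have : E ∩ blk a l ⁻¹' D = ⋃ v ∈ D, E ∩ blk a l ⁻¹' {v} := by
      ext x; simp
    rw [this, measure_biUnion_finset]
    · simp [hpiece]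
    · intro v _ w _ hvw
      rw [Function.onFun, Set.disjoint_left]
      rintro x ⟨_, h1⟩ ⟨_, h2⟩
      exact hvw (h1.symm.trans h2)
    · exact fun v _ => hE.inter (isOpen_blk a l _).measurableSet
  have huniv := hsum Finset.univ
  simp at huniv
  rw [hsum D, huniv]
  ring
end blocks

/-- The tree of initial segments of elements of `Y`. -/
def treeOf (Y : Set Cantor) : Set FinSeq := {σ | ∃ x ∈ Y, ∃ n, σ = res x n}

lemma res_prefix (x : Cantor) {m n : ℕ} (h : m ≤ n) : res x m <+: res x n := by
  obtain ⟨k, rfl⟩ := Nat.exists_eq_add_of_le h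
  simp [res, List.range_add]

lemma res_eq_iff (x y : Cantor) (n : ℕ) : res x n = res y n ↔ ∀ i < n, x i = y i := by
  simp [res]

lemma treeOf_isTree {Y : Set Cantor} (hY : Y.Nonempty) : IsTree (treeOf Y) := by
  refine ⟨?_, ?_, ?_⟩
  · obtain ⟨x, hx⟩ := hY
    exact ⟨res x 0, x, hx, 0, rfl⟩
  · rintro σ τ h ⟨x, hx, n, rfl⟩
    refine ⟨x, hx, σ.length, ?_⟩
    have hl := h.length_le
    rw [res_length] at hl
    exact (List.prefix_of_prefix_length_le h (res_prefix x hl) (by rw [res_length])).eq_of_length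
      (by rw [res_length])
  · rintro σ ⟨x, hx, m, rfl⟩ n hn
    rw [res_length] at hn
    exact ⟨res x n, ⟨x, hx, n, rfl⟩, res_prefix x hn.le, res_length x n⟩

lemma level_treeOf (Y : Set Cantor) (n : ℕ) :
    {τ ∈ treeOf Y | τ.length = n} = (fun x => res x n) '' Y := by
  ext τ
  constructor
  · rintro ⟨⟨x, hx, m, rfl⟩, h⟩
    rw [res_length] at h
    subst h
    exact ⟨x, hx, rfl⟩
  · rintro ⟨x, hx, rfl⟩
    exact ⟨⟨x, hx, n, rfl⟩, res_length x n⟩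

lemma finite_res (Y : Set Cantor) (n : ℕ) : ((fun x => res x n) '' Y).Finite :=
  (finite_length n).subset (by rintro _ ⟨x, _, rfl⟩; exact res_length x n)

lemma ncard_res_mono (Y : Set Cantor) {m n : ℕ} (h : m ≤ n) :
    ((fun x => res x m) '' Y).ncard ≤ ((fun x => res x n) '' Y).ncard := by
  have : (fun x => res x m) '' Y = (List.take m) '' ((fun x => res x n) '' Y) := by
    rw [Set.image_image]
    refine Set.image_congr fun x _ => ?_
    simp [res, ← List.map_take, List.take_range, h]
  rw [this]
  exact Set.ncard_image_le (finite_res Y n)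

lemma ncard_res_add (Y : Set Cantor) (a l : ℕ) :
    ((fun x => res x (a + l)) '' Y).ncard ≤
      ((fun x => res x a) '' Y).ncard * (blk a l '' Y).ncard := by
  rw [← Set.ncard_prod]
  refine Set.ncard_le_ncard_of_injOn (fun σ => (σ.take a, blk a l (pad σ))) ?_ ?_
    ((finite_res Y a).prod (Set.toFinite _))
  · rintro _ ⟨x, hx, rfl⟩
    refine ⟨⟨x, hx, ?_⟩, ⟨x, hx, ?_⟩⟩
    · simp [res, ← List.map_take, List.take_range]
    · funext i
      simp only [blk]
      rw [pad_res]; omega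
  · rintro _ ⟨x, hx, rfl⟩ _ ⟨y, hy, rfl⟩ h
    simp only [Prod.mk.injEq] at h
    obtain ⟨h1, h2⟩ := h
    simp only [res_eq_iff]
    intro i hi
    by_cases hia : i < a
    · have : res x a = res y a := by
        simpa [res, ← List.map_take, List.take_range] using h1
      exact (res_eq_iff x y a).1 this i hia
    · have := congrFun h2 ⟨i - a, by omega⟩
      simp only [blk] at this
      rw [pad_res _ _ _ (by omega), pad_res _ _ _ (by omega)] at this
      rwa [show a + (i - a) = i by omega] at this

theorem forward (X : Set Cantor) (hX : NullAdditive X) (f : ℕ → ℕ) (hf : Corset f) :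
    ∃ S : ℕ → Set FinSeq,
        (∀ m, IsTree (S m) ∧ widthLe (S m) f) ∧ X ⊆ ⋃ m, LimT (S m) := by
  classical
  obtain ⟨hmono, hpos, htend⟩ := hf
  -- the bound on the number of nodes
  let H : ℕ → ℕ := fun n => ∏ k ∈ Finset.range n, 2 ^ (k + 1)
  have hg : ∀ n, ∃ g, H (n + 2) ≤ f g := fun n =>
    (htend.eventually (Filter.eventually_ge_atTop (H (n + 2)))).exists
  choose g hg using hg
  have hcomb := fun n => comb n (g n)
  choose L hL A hA1 hA2 using hcomb
  let F : ℕ → ℕ := fun n => ∑ i ∈ Finset.range n, L i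
  have hFs : ∀ n, F (n + 1) = F n + L n := fun n => Finset.sum_range_succ _ _
  have hFm : Monotone F := monotone_nat_of_le_succ fun n => by rw [hFs]; omega
  have hHF : ∀ r, 1 ≤ r → H (r + 1) ≤ f (F r) := by
    intro r hr
    obtain ⟨n, rfl⟩ := Nat.exists_eq_add_of_le' hr
    refine (hg n).trans (hmono ?_)
    rw [hFs]; have := hL n; omega
  let b : (n : ℕ) → Cantor → (Fin (L n) → ZMod 2) := fun n => blk (F n) (L n)
  -- the null set
  let N : Set Cantor := Filter.limsup (fun n => b n ⁻¹' (A n : Set _)) Filter.atTop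
  have hN : μC N = 0 := by
    apply measure_limsup_atTop_eq_zero
    have : ∀ n, μC (b n ⁻¹' (A n : Set _)) ≤ (1/2 : ENNReal) ^ n := by
      intro n
      have h1 := blk_indep (F n) (L n) Set.univ MeasurableSet.univ (fun _ _ _ => trivial) (A n)
      rw [Set.univ_inter, measure_univ, mul_one] at h1
      have h2 : (2 : ENNReal) ^ (n + 1) * (A n).card ≤ 2 * 2 ^ (L n) := by exact_mod_cast hA1 n
      rw [← h1] at h2
      rw [one_div, ← ENNReal.inv_pow, ENNReal.le_inv_iff_mul_le]
      have h3 : (2 * 2 ^ (L n) : ENNReal) * (μC (b n ⁻¹' (A n : Set _)) * 2 ^ n)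
          ≤ (2 * 2 ^ (L n)) * 1 := by
        rw [mul_one]
        refine le_trans (le_of_eq ?_) h2
        simp only [b]
        ring
      exact (ENNReal.mul_le_mul_iff_right (by simp) (by finiteness)).1 h3
    refine ne_top_of_le_ne_top ?_ (ENNReal.tsum_le_tsum this)
    rw [ENNReal.tsum_geometric]; simp
  have hXN := hX N hN
  -- a compact set of positive measure avoiding X + N
  obtain ⟨Q, hQsub, hQc, hQpos⟩ : ∃ Q ⊆ (toMeasurable μC (X + N))ᶜ, IsCompact Q ∧ 0 < μC Q := by
    have hm : MeasurableSet (toMeasurable μC (X + N))ᶜ := (measurableSet_toMeasurable _ _).compl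
    refine hm.exists_lt_isCompact (r := 0) ?_
    rw [prob_compl_eq_one_sub (measurableSet_toMeasurable _ _), measure_toMeasurable, hXN]
    simp
  let 𝔹 := TopologicalSpace.countableBasis Cantor
  have h𝔹c : 𝔹.Countable := TopologicalSpace.countable_countableBasis _
  have h𝔹 : TopologicalSpace.IsTopologicalBasis 𝔹 := TopologicalSpace.isBasis_countableBasis _
  let Z : Set Cantor := ⋃ U ∈ {U ∈ 𝔹 | μC (Q ∩ U) = 0}, U
  have hZo : IsOpen Z := isOpen_biUnion fun U hU => h𝔹.isOpen hU.1
  have hZ0 : μC (Q ∩ Z) = 0 := by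
    have : Q ∩ Z = ⋃ U ∈ {U ∈ 𝔹 | μC (Q ∩ U) = 0}, Q ∩ U := by
      simp only [Z, Set.inter_iUnion₂]
    rw [this, measure_biUnion_null_iff (h𝔹c.mono fun U hU => hU.1)]
    exact fun U hU => hU.2
  let P : Set Cantor := Q \ Z
  have hPc : IsCompact P := hQc.diff hZo
  have hPm : ∀ U, μC (P ∩ U) = μC (Q ∩ U) := by
    intro U
    refine le_antisymm (measure_mono (Set.inter_subset_inter_left _ Set.sdiff_subset)) ?_
    calc μC (Q ∩ U) ≤ μC ((P ∩ U) ∪ (Q ∩ Z)) := by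
          refine measure_mono fun x hx => ?_
          by_cases hz : x ∈ Z
          · exact Or.inr ⟨hx.1, hz⟩
          · exact Or.inl ⟨⟨hx.1, hz⟩, hx.2⟩
      _ ≤ μC (P ∩ U) + μC (Q ∩ Z) := measure_union_le _ _
      _ = _ := by rw [hZ0, add_zero]
  have hPpos : ∀ U ∈ 𝔹, (P ∩ U).Nonempty → 0 < μC (P ∩ U) := by
    rintro U hU ⟨x, hxP, hxU⟩
    rw [pos_iff_ne_zero]
    intro h0
    rw [hPm] at h0
    exact hxP.2 (Set.mem_biUnion (show U ∈ {U ∈ 𝔹 | μC (Q ∩ U) = 0} from ⟨hU, h0⟩) hxU)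
  have hPne : P.Nonempty := by
    have := hPm Set.univ
    rw [Set.inter_univ, Set.inter_univ] at this
    rw [← this] at hQpos
    exact nonempty_of_measure_ne_zero (ne_of_gt hQpos)
  -- closed pieces
  let C : ℕ → Cantor → Set Cantor := fun m x => {y | ∀ n, m ≤ n → b n (x + y) ∉ A n}
  have hCc : ∀ m x, IsClosed (C m x) := by
    intro m x
    have : C m x = ⋂ n, ⋂ (_ : m ≤ n), (fun y => x + y) ⁻¹' (b n ⁻¹' ((A n : Set _)ᶜ)) := by
      ext y; simp [C]
    rw [this]
    exact isClosed_iInter fun n => isClosed_iInter fun _ =>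
      (isClosed_blk _ _ _).preimage (continuous_const_add x)
  have hself : ∀ x y : Cantor, x + (x + y) = y := by
    intro x y
    rw [← add_assoc, show x + x = 0 from funext fun i => CharTwo.add_self_eq_zero _, zero_add]
  have hbaire : ∀ x ∈ X, ∃ m, ∃ U ∈ 𝔹, (P ∩ U).Nonempty ∧ P ∩ U ⊆ C m x := by
    intro x hx
    have hcover : ∀ y ∈ P, ∃ m, y ∈ C m x := by
      intro y hy
      by_contra hcon
      push Not at hcon
      have hyN : x + y ∈ N := by
        simp only [N]
        rw [Filter.mem_limsup_iff_frequently_mem, Filter.frequently_atTop]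
        intro m
        have := hcon m
        simp only [C, Set.mem_ofPred_eq] at this
        push Not at this
        exact this
      have : y ∈ X + N := ⟨x, hx, x + y, hyN, hself x y⟩
      exact hQsub hy.1 (subset_toMeasurable _ _ this)
    have : CompactSpace P := isCompact_iff_compactSpace.1 hPc
    have : Nonempty P := hPne.to_subtype
    obtain ⟨m, ⟨y, hy⟩⟩ := nonempty_interior_of_iUnion_of_closed
      (f := fun m => ((↑) : P → Cantor) ⁻¹' (C m x))
      (fun m => (hCc m x).preimage continuous_subtype_val)
      (by ext y; simpa using hcover y y.2)
    obtain ⟨V, hV, hVo, hyV⟩ := mem_interior.1 hy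
    obtain ⟨W, hW, rfl⟩ := isOpen_induced_iff.1 hVo
    obtain ⟨U, hU, hyU, hUW⟩ := h𝔹.exists_subset_of_mem_open (show (y : Cantor) ∈ W from hyV) hW
    refine ⟨m, U, hU, ⟨y, y.2, hyU⟩, ?_⟩
    rintro z ⟨hzP, hzU⟩
    exact hV (show (⟨z, hzP⟩ : P) ∈ _ from hUW hzU)
  -- the pieces of X
  let Y : ℕ → Set Cantor → Set Cantor := fun m U => {x | P ∩ U ⊆ C m x}
  have hsmall : ∀ m, ∀ U ∈ 𝔹, (P ∩ U).Nonempty →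
      ∃ r0, ∀ n, r0 ≤ n → (b n '' Y m U).ncard < 2 ^ (n + 1) := by
    intro m U hU hne
    by_contra hcon
    push Not at hcon
    have hp := hPpos U hU hne
    let B : (n : ℕ) → Finset (Fin (L n) → ZMod 2) := fun n => (Set.toFinite (b n '' Y m U)).toFinset
    have hBc : ∀ n, (B n).card = (b n '' Y m U).ncard := fun n =>
      (Set.ncard_eq_toFinset_card _ _).symm
    -- P ∩ U avoids A n + B n
    have havoid : ∀ n, m ≤ n → P ∩ U ⊆ b n ⁻¹' (((A n + B n)ᶜ : Finset _) : Set _) := by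
      intro n hn y hy
      simp only [Set.mem_preimage, Finset.coe_compl, Set.mem_compl_iff, Finset.mem_coe]
      intro hmem
      obtain ⟨a, ha, c, hc, hac⟩ := Finset.mem_add.1 hmem
      simp only [B, Set.Finite.mem_toFinset] at hc
      obtain ⟨x, hx, rfl⟩ := hc
      apply hx hy n hn
      have : b n (x + y) = a := by
        simp only [b, blk_add] at hac ⊢
        rw [← hac, add_comm a, ← add_assoc,
          show blk (F n) (L n) x + blk (F n) (L n) x = 0 from
            funext fun i => CharTwo.add_self_eq_zero _, zero_add]
      rw [this]; exact ha
    have hiter : ∀ r : ℕ, ∃ n0, m ≤ n0 ∧ ∃ E : Set Cantor, MeasurableSet E ∧ P ∩ U ⊆ E ∧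
        (∀ x ∈ E, ∀ y, (∀ i < F n0, y i = x i) → y ∈ E) ∧ μC E ≤ (3/4 : ENNReal) ^ r := by
      intro r
      induction r with
      | zero => exact ⟨m, le_rfl, Set.univ, MeasurableSet.univ, Set.subset_univ _,
          fun _ _ _ _ => trivial, by simp [prob_le_one]⟩
      | succ r ih =>
        obtain ⟨n0, hmn, E, hE, hPE, hEinv, hEm⟩ := ih
        obtain ⟨n, hn, hnB⟩ := hcon n0
        refine ⟨n + 1, by omega, E ∩ b n ⁻¹' (((A n + B n)ᶜ : Finset _) : Set _),
          hE.inter (isOpen_blk _ _ _).measurableSet,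
          Set.subset_inter hPE (havoid n (by omega)), ?_, ?_⟩
        · rintro x ⟨hxE, hxb⟩ y hy
          refine ⟨hEinv x hxE y fun i hi => hy i (hi.trans_le (hFm (by omega))), ?_⟩
          have : b n y = b n x := by
            funext i
            apply hy
            rw [hFs]; omega
          simpa only [Set.mem_preimage, this] using hxb
        · have hind := blk_indep (F n) (L n) E hE (by
            intro v x hx
            refine hEinv x hx _ fun i hi => ?_
            have : ¬ (F n ≤ i ∧ i < F n + L n) := by
              have := hFm hn; omega
            simp [ext0, this]) ((A n + B n)ᶜ)
          have hcard : (2 : ENNReal) ^ L n ≤ 4 * ((A n + B n).card : ENNReal) := by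
            exact_mod_cast hA2 n (B n) (by rw [hBc]; exact hnB)
          have hcc : 4 * ((A n + B n)ᶜ.card : ENNReal) ≤ 3 * 2 ^ L n := by
            have h1 := Finset.card_add_card_compl (A n + B n)
            have h2 := hA2 n (B n) (by rw [hBc]; exact hnB)
            have h3 : Fintype.card (Fin (L n) → ZMod 2) = 2 ^ L n := by simp [ZMod.card]
            rw [h3] at h1
            have : 4 * (A n + B n)ᶜ.card ≤ 3 * 2 ^ L n := by omega
            exact_mod_cast this
          have h4 : (4 * 2 ^ L n : ENNReal) * μC (E ∩ b n ⁻¹' (((A n + B n)ᶜ : Finset _) : Set _))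
              ≤ (4 * 2 ^ L n) * (3/4 : ENNReal) ^ (r + 1) := by
            calc _ = 4 * (2 ^ L n * μC (E ∩ b n ⁻¹' (((A n + B n)ᶜ : Finset _) : Set _))) := by ring
              _ = (4 * ((A n + B n)ᶜ.card : ENNReal)) * μC E := by rw [hind]; ring
              _ ≤ (3 * 2 ^ L n) * (3/4 : ENNReal) ^ r := by gcongr
              _ = ((4 * (3/4)) * 2 ^ L n) * (3/4 : ENNReal) ^ r := by
                  rw [ENNReal.mul_div_cancel (by simp) (by simp)]
              _ = _ := by ring
          exact (ENNReal.mul_le_mul_iff_right (by simp) (by finiteness)).1 h4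
    have ht : Filter.Tendsto (fun k : ℕ => (3/4 : ENNReal) ^ k) Filter.atTop (nhds 0) :=
      ENNReal.tendsto_pow_atTop_nhds_zero_of_lt_one (by
        rw [ENNReal.div_lt_iff (by simp) (by simp)]; norm_num)
    obtain ⟨k, hk⟩ := (ht.eventually (gt_mem_nhds hp)).exists
    obtain ⟨_, _, E, _, hPE, _, hEm⟩ := hiter k
    exact absurd ((measure_mono hPE).trans hEm) (not_le.2 hk)
  -- width of small pieces
  have hwidth : ∀ (Y' : Set Cantor) (r0 : ℕ), 1 ≤ r0 →
      (∀ n, r0 ≤ n → (b n '' Y').ncard ≤ 2 ^ (n + 1)) →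
      (∀ x ∈ Y', ∀ y ∈ Y', res x (F r0) = res y (F r0)) → widthLe (treeOf Y') f := by
    intro Y' r0 hr0 hb hres
    have hbase : ((fun x => res x (F r0)) '' Y').ncard ≤ 1 := by
      rw [Set.ncard_le_one (finite_res _ _)]
      rintro _ ⟨x, hx, rfl⟩ _ ⟨y, hy, rfl⟩
      exact hres x hx y hy
    have hH : ∀ r, r0 ≤ r → ((fun x => res x (F r)) '' Y').ncard ≤ H r := by
      intro r hr
      induction r, hr using Nat.le_induction with
      | base =>
        have hHpos : 0 < H r0 := Finset.prod_pos fun k _ => by positivity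
        exact hbase.trans hHpos
      | succ r hr ih =>
        rw [hFs]
        refine (ncard_res_add Y' (F r) (L r)).trans ?_
        simp only [H, Finset.prod_range_succ]
        exact Nat.mul_le_mul ih (hb r hr)
    intro n
    rw [level_treeOf]
    by_cases hn : n ≤ F r0
    · exact (ncard_res_mono Y' hn).trans (hbase.trans (hpos n))
    · -- find r
      have hex : ∃ r, r0 ≤ r ∧ F r < n ∧ n ≤ F (r + 1) := by
        by_contra hcon
        push Not at hcon
        have hall : ∀ r, r0 ≤ r → F r < n := by
          intro r hr
          induction r, hr using Nat.le_induction with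
          | base => omega
          | succ r hr ih => exact hcon r hr ih
        -- F is unbounded
        have hft : ∀ r, r0 ≤ r → H (r + 1) ≤ f n := fun r hr =>
          (hHF r (hr0.trans hr)).trans (hmono (hall r hr).le)
        have hHge : ∀ r, r < H r := by
          intro r
          induction r with
          | zero => simp [H]
          | succ r ih =>
            have : H (r + 1) = H r * 2 ^ (r + 1) := Finset.prod_range_succ _ _
            rw [this]
            have h2 : H r * 2 ≤ H r * 2 ^ (r + 1) :=
              Nat.mul_le_mul_left _ (by rw [pow_succ]; have := Nat.one_le_two_pow (n := r); omega)
            omega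
        have h1 := hft (r0 + f n) (by omega)
        have h2 := hHge (r0 + f n + 1)
        omega
      obtain ⟨r, hr, h1, h2⟩ := hex
      calc _ ≤ ((fun x => res x (F (r + 1))) '' Y').ncard := ncard_res_mono Y' h2
        _ ≤ H (r + 1) := hH _ (by omega)
        _ ≤ f (F r) := hHF r (by omega)
        _ ≤ f n := hmono h1.le
  -- countable family
  have hgood : ∀ Y' : Set Cantor, widthLe (treeOf Y') f →
      ∃ S, IsTree S ∧ widthLe S f ∧ Y' ⊆ LimT S := by
    intro Y' hY'
    rcases Y'.eq_empty_or_nonempty with rfl | hne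
    · refine ⟨treeOf {0}, treeOf_isTree (Set.singleton_nonempty _), ?_, Set.empty_subset _⟩
      intro n
      rw [level_treeOf, Set.image_singleton, Set.ncard_singleton]
      exact hpos n
    · exact ⟨treeOf Y', treeOf_isTree hne, hY', fun x hx n => ⟨x, hx, n, rfl⟩⟩
  have hr0 : ∀ (m : ℕ) (U : Set Cantor), ∃ r0, 1 ≤ r0 ∧ (U ∈ 𝔹 → (P ∩ U).Nonempty →
      ∀ n, r0 ≤ n → (b n '' Y m U).ncard ≤ 2 ^ (n + 1)) := by
    intro m U
    by_cases h : U ∈ 𝔹 ∧ (P ∩ U).Nonempty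
    · obtain ⟨r, hr⟩ := hsmall m U h.1 h.2
      exact ⟨r + 1, by omega, fun _ _ n hn => (hr n (by omega)).le⟩
    · exact ⟨1, le_rfl, fun h1 h2 => absurd ⟨h1, h2⟩ h⟩
  choose r0 hr01 hr02 using hr0
  have : Countable 𝔹 := h𝔹c.to_subtype
  let ι := ℕ × 𝔹 × FinSeq
  let piece : ι → Set Cantor := fun i => {x ∈ Y i.1 i.2.1 | res x (F (r0 i.1 i.2.1)) = i.2.2}
  have hS : ∀ i : ι, ∃ S, (IsTree S ∧ widthLe S f) ∧
      ((P ∩ i.2.1).Nonempty → piece i ⊆ LimT S) := by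
    rintro ⟨m, U, t⟩
    by_cases hne : (P ∩ U.1).Nonempty
    · obtain ⟨S, h1, h2, h3⟩ := hgood (piece (m, U, t)) (by
        refine hwidth _ (r0 m U) (hr01 m U) (fun n hn => ?_) ?_
        · refine le_trans (Set.ncard_le_ncard ?_ (Set.toFinite _)) (hr02 m U U.2 hne n hn)
          exact Set.image_mono fun x hx => hx.1
        · intro x hx y hy
          exact hx.2.trans hy.2.symm)
      exact ⟨S, ⟨h1, h2⟩, fun _ => h3⟩
    · obtain ⟨S, h1, h2, h3⟩ := hgood ∅ (by
        intro n; rw [level_treeOf]; simp)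
      exact ⟨S, ⟨h1, h2⟩, fun h => absurd h hne⟩
  choose S hS1 hS2 using hS
  have hXcov : X ⊆ ⋃ i, LimT (S i) := by
    intro x hx
    obtain ⟨m, U, hU, hne, hsub⟩ := hbaire x hx
    refine Set.mem_iUnion.2 ⟨(m, ⟨U, hU⟩, res x (F (r0 m U))), ?_⟩
    exact hS2 (m, ⟨U, hU⟩, res x (F (r0 m U))) hne ⟨hsub, rfl⟩
  rcases isEmpty_or_nonempty ι with hemp | hnon
  · obtain ⟨T, h1, h2, h3⟩ := hgood ∅ (by intro n; rw [level_treeOf]; simp)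
    refine ⟨fun _ => T, fun _ => ⟨h1, h2⟩, fun x hx => ?_⟩
    obtain ⟨i, _⟩ := Set.mem_iUnion.1 (hXcov hx)
    exact hemp.elim i
  · obtain ⟨e, he⟩ := exists_surjective_nat ι
    refine ⟨fun n => S (e n), fun n => hS1 _, fun x hx => ?_⟩
    obtain ⟨i, hi⟩ := Set.mem_iUnion.1 (hXcov hx)
    obtain ⟨n, rfl⟩ := he i
    exact Set.mem_iUnion.2 ⟨n, hi⟩

/-- Theorem 13, (a) ↔ (d): `X` is null-additive iff for every corset `f`
there are countably many trees of width `f` whose branches cover `X`. -/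
theorem stmt9 (X : Set Cantor) :
    NullAdditive X ↔
      ∀ f : ℕ → ℕ, Corset f → ∃ S : ℕ → Set FinSeq,
        (∀ m, IsTree (S m) ∧ widthLe (S m) f) ∧ X ⊆ ⋃ m, LimT (S m) := by
  exact ⟨fun h f hf => forward X h f hf, backward X⟩
end

section
/- For every n ∈ ω and 0 < p < 1 there is N > n such that for every n' ≥ N and every t ⊆ 2^n there is t' ⊆ 2^{n'} satisfying: (i) every ζ ∈ t' has ζ↾n ∈ t; (ii) for each η ∈ t, |{ζ ∈ t' : η ⊑ ζ}| ≥ 2^{n'−n}·p; (iii) whenever 0 < k ≤ 2^n, η, ν_0, …, ν_{k−1} ∈ 2^n, ν_0^+, …, ν_{k−1}^+ ∈ 2^{n'} are pairwise distinct with ν_l = ν_l^+↾n, and η + ν_l ∈ t for all l < k, then |{η^+ ∈ 2^{n'} : η ⊑ η^+ and η^+ + ν_l^+ ∈ t' for all l < k}| ≤ 2^{n'−n}·p^{k−1}. -/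
open MeasureTheory Pointwise

/-- Restriction of a vector in `2^{n'}` to `2^n`. -/
def restr {n n' : ℕ} (h : n ≤ n') (ζ : Fin n' → ZMod 2) : Fin n → ZMod 2 :=
  fun i => ζ (Fin.castLE h i)

section Helpers

open ProbabilityTheory

lemma pi_block {V : Type*} [Fintype V] [DecidableEq V] (m : Measure Bool) [IsProbabilityMeasure m]
    (b : Bool) (B : Finset V) :
    (Measure.pi (fun _ : V => m)) {ω | ∀ v ∈ B, ω v = b} = (m {b}) ^ B.card := by
  have : {ω : V → Bool | ∀ v ∈ B, ω v = b}
      = Set.pi Set.univ (fun v => if v ∈ B then {b} else Set.univ) := by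
    ext ω
    simp only [Set.mem_ofPred_eq, Set.mem_pi, Set.mem_univ, true_imp_iff]
    refine forall_congr' fun v => ?_
    by_cases hv : v ∈ B <;> simp [hv]
  rw [this, Measure.pi_pi]
  have : ∀ v : V, m (if v ∈ B then {b} else Set.univ) = if v ∈ B then m {b} else 1 := by
    intro v
    split_ifs
    · rfl
    · exact measure_univ
  rw [Finset.prod_congr rfl (fun v _ => this v)]
  simp [Finset.prod_ite]

lemma indep_block {V ι : Type*} [Fintype V] [DecidableEq V] (m : Measure Bool)
    [IsProbabilityMeasure m] (b : Bool) (B : ι → Finset V)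
    (hB : ∀ i j, i ≠ j → Disjoint (B i) (B j)) :
    iIndepSet (fun i => {ω : V → Bool | ∀ v ∈ B i, ω v = b}) (Measure.pi (fun _ : V => m)) := by
  classical
  rw [iIndepSet_iff_meas_biInter (fun i => Set.Finite.measurableSet (Set.toFinite _))]
  intro s
  have : (⋂ i ∈ s, {ω : V → Bool | ∀ v ∈ B i, ω v = b})
      = {ω : V → Bool | ∀ v ∈ s.biUnion B, ω v = b} := by
    ext ω
    simp only [Set.mem_iInter, Set.mem_ofPred_eq, Finset.mem_biUnion]
    constructor
    · rintro h v ⟨i, hi, hv⟩; exact h i hi v hv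
    · intro h i hi v hv; exact h v ⟨i, hi, hv⟩
  rw [this, pi_block, Finset.card_biUnion (fun i _ j _ hij => hB i j hij)]
  simp_rw [pi_block]
  rw [Finset.prod_pow_eq_pow_sum]

open Classical in
lemma tail_block {V ι : Type*} [Fintype V] [DecidableEq V] (m : Measure Bool)
    [IsProbabilityMeasure m] (b : Bool) (k : ℕ) (A : Finset ι) (B : ι → Finset V)
    (hB : ∀ i ∈ A, ∀ j ∈ A, i ≠ j → Disjoint (B i) (B j)) (hk : ∀ i ∈ A, (B i).card = k)
    (M δ : ℝ) (hδ : 0 < δ) (hM : (A.card : ℝ) ≤ M) :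
    (Measure.pi (fun _ : V => m)).real
      {ω | (m.real {b}) ^ k * A.card + δ ≤ ((A.filter fun i => ∀ v ∈ B i, ω v = b).card : ℝ)}
      ≤ Real.exp (-2 * δ ^ 2 / M) := by
  set P := Measure.pi (fun _ : V => m) with hP
  rcases A.eq_empty_or_nonempty with rfl | hA
  · have : {ω : V → Bool | (m.real {b}) ^ k * (∅ : Finset ι).card + δ ≤
        (((∅ : Finset ι).filter fun i => ∀ v ∈ B i, ω v = b).card : ℝ)} = ∅ := by
      ext ω; simp [hδ]
    rw [this]; simp [Real.exp_nonneg]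
  have hApos : (0 : ℝ) < A.card := by exact_mod_cast hA.card_pos
  let E : A → Set (V → Bool) := fun i => {ω | ∀ v ∈ B i, ω v = b}
  have hEm : ∀ i, MeasurableSet (E i) := fun i => Set.Finite.measurableSet (Set.toFinite _)
  have hind : iIndepSet E P := indep_block m b (fun i : A => B i)
    (fun i j hij => hB i i.2 j j.2 (fun h => hij (Subtype.ext h)))
  have hf : iIndepFun (fun i => (E i).indicator fun _ => (1 : ℝ)) P :=
    hind.iIndepFun_indicator
  have hint : ∀ i, ∫ ω, (E i).indicator (fun _ => (1 : ℝ)) ω ∂P = (m.real {b}) ^ k := by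
    intro i
    rw [integral_indicator (hEm i)]
    simp only [integral_const, smul_eq_mul, mul_one, measureReal_restrict_apply_univ]
    rw [measureReal_def, pi_block, hk i i.2, ENNReal.toReal_pow, measureReal_def]
  have hsub : ∀ i ∈ (Finset.univ : Finset A),
      HasSubgaussianMGF (fun ω => (E i).indicator (fun _ => (1 : ℝ)) ω
        - P[(E i).indicator (fun _ => (1 : ℝ))]) ((‖(1 : ℝ) - 0‖₊ / 2) ^ 2) P := by
    intro i _
    apply hasSubgaussianMGF_of_mem_Icc
    · exact (measurable_const.indicator (hEm i)).aemeasurable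
    · refine Filter.Eventually.of_forall fun ω => ?_
      by_cases h : ω ∈ E i <;> simp [h]
  have hf' := hf.comp (fun i x => x - P[(E i).indicator (fun _ => (1 : ℝ))])
    (fun i => measurable_id.sub_const _)
  have key := HasSubgaussianMGF.measure_sum_ge_le_of_iIndepFun hf' hsub hδ.le
  have hset : {ω | (m.real {b}) ^ k * A.card + δ ≤
      ((A.filter fun i => ∀ v ∈ B i, ω v = b).card : ℝ)} =
      {ω | δ ≤ ∑ i : A, ((fun x => x - P[(E i).indicator (fun _ => (1 : ℝ))]) ∘
        (E i).indicator (fun _ => (1 : ℝ))) ω} := by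
    ext ω
    have h1 : ∑ i : A, (E i).indicator (fun _ => (1 : ℝ)) ω
        = ((A.filter fun i => ∀ v ∈ B i, ω v = b).card : ℝ) := by
      rw [Finset.card_filter]
      push_cast
      rw [← Finset.sum_coe_sort A]
      refine Finset.sum_congr rfl fun i _ => ?_
      simp [E, Set.indicator_apply]
    simp only [Set.mem_ofPred_eq, Function.comp, Finset.sum_sub_distrib, h1, hint]
    simp
    constructor <;> intro h <;> linarith
  rw [hset]
  refine key.trans (Real.exp_le_exp.2 ?_)
  simp
  rw [neg_div, neg_div, neg_le_neg_iff]
  rw [div_le_div_iff₀ (by linarith) (by positivity)]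
  have : 0 ≤ δ ^ 2 := by positivity
  nlinarith

open Classical in
lemma tail_shift {n k : ℕ} (m : Measure Bool) [IsProbabilityMeasure m] (b : Bool)
    (A : Finset (Fin n → ZMod 2)) (νp : Fin k → Fin n → ZMod 2) (hν : Function.Injective νp)
    (M ε : ℝ) (hε : 0 < ε) (hM0 : 0 < M) (hM : (A.card : ℝ) ≤ M) :
    (Measure.pi (fun _ : Fin n → ZMod 2 => m)).real
      {ω | ((m.real {b}) ^ k + ε) * M ≤ ((A.filter fun x => ∀ l, ω (x + νp l) = b).card : ℝ)}
      ≤ 2 ^ (k * k) * Real.exp (-2 * ε ^ 2 * M / (2 ^ (k * k)) ^ 2) := by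
  have hex : ∀ q : Fin k × Fin k, ∃ f : (Fin n → ZMod 2) → ZMod 2,
      ∀ x y, f x = f y → x + νp q.1 = y + νp q.2 → q.1 = q.2 := by
    rintro ⟨l, l'⟩
    by_cases h : l = l'
    · exact ⟨fun _ => 0, fun _ _ _ _ => h⟩
    · have : νp l ≠ νp l' := fun h' => h (hν h')
      obtain ⟨i, hi⟩ := Function.ne_iff.1 this
      refine ⟨fun x => x i, fun x y hxy he => absurd ?_ hi⟩
      have := congrFun he i
      simp only [Pi.add_apply] at this
      have hxy' : x i = y i := hxy
      rw [hxy'] at this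
      exact add_left_cancel this
  choose f hf using hex
  let c : (Fin n → ZMod 2) → (Fin k × Fin k → ZMod 2) := fun x q => f q x
  let B : (Fin n → ZMod 2) → Finset (Fin n → ZMod 2) :=
    fun x => Finset.univ.image fun l => x + νp l
  have hBk : ∀ x, (B x).card = k := by
    intro x
    rw [Finset.card_image_of_injective _ (fun l l' h => hν (add_left_cancel h))]
    simp
  have hcard : (Fintype.card (Fin k × Fin k → ZMod 2) : ℝ) = 2 ^ (k * k) := by
    simp [ZMod.card]
  set C : ℝ := 2 ^ (k * k) with hC
  have hCpos : 0 < C := by positivity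
  let Bad : (Fin k × Fin k → ZMod 2) → Set ((Fin n → ZMod 2) → Bool) := fun j =>
    {ω | (m.real {b}) ^ k * (A.filter fun x => c x = j).card + ε * M / C ≤
      (((A.filter fun x => c x = j).filter fun i => ∀ v ∈ B i, ω v = b).card : ℝ)}
  have hbad : ∀ j, (Measure.pi (fun _ : Fin n → ZMod 2 => m)).real (Bad j)
      ≤ Real.exp (-2 * ε ^ 2 * M / C ^ 2) := by
    intro j
    refine (tail_block m b k (A.filter fun x => c x = j) B ?_ (fun i _ => hBk i) M (ε * M / C)
      (by positivity) ?_).trans (Real.exp_le_exp.2 (le_of_eq ?_))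
    · intro x hx y hy hxy
      simp only [Finset.mem_filter] at hx hy
      rw [Finset.disjoint_left]
      intro v hvx hvy
      simp only [B, Finset.mem_image, Finset.mem_univ, true_and] at hvx hvy
      obtain ⟨l, hl⟩ := hvx
      obtain ⟨l', hl'⟩ := hvy
      have hcc : c x = c y := hx.2.trans hy.2.symm
      have h2 : x + νp l = y + νp l' := hl.trans hl'.symm
      have h3 : l = l' := hf (l, l') x y (congrFun hcc (l, l')) h2
      subst h3
      exact hxy (add_right_cancel h2)
    · refine le_trans ?_ hM
      exact_mod_cast Finset.card_filter_le _ _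
    · field_simp
  calc _ ≤ (Measure.pi (fun _ : Fin n → ZMod 2 => m)).real (⋃ j, Bad j) := by
        refine measureReal_mono ?_
        intro ω hω
        by_contra hcon
        simp only [Set.mem_iUnion, not_exists, Bad, Set.mem_ofPred_eq, not_le] at hcon hω
        have h1 : ((A.filter fun x => ∀ l, ω (x + νp l) = b).card : ℝ) =
            ∑ j, (((A.filter fun x => c x = j).filter fun i => ∀ v ∈ B i, ω v = b).card : ℝ) := by
          rw [Finset.card_eq_sum_card_fiberwise (f := c) (t := Finset.univ) (by simp)]
          push_cast
          refine Finset.sum_congr rfl fun j _ => ?_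
          congr 2
          ext x
          simp [B]
          tauto
        have h2 : (A.card : ℝ) = ∑ j, ((A.filter fun x => c x = j).card : ℝ) := by
          rw [Finset.card_eq_sum_card_fiberwise (f := c) (t := Finset.univ) (by simp)]
          push_cast
          rfl
        have h3 := Finset.sum_lt_sum_of_nonempty (s := Finset.univ) Finset.univ_nonempty
          (fun j _ => hcon j)
        rw [← h1, Finset.sum_add_distrib, ← Finset.mul_sum, ← h2] at h3
        rw [Finset.sum_const, Finset.card_univ, nsmul_eq_mul, hcard,
          mul_div_cancel₀ _ hCpos.ne'] at h3
        have h4 : (m.real {b}) ^ k * A.card ≤ (m.real {b}) ^ k * M :=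
          mul_le_mul_of_nonneg_left hM (by positivity)
        linarith
    _ ≤ ∑ j, (Measure.pi (fun _ : Fin n → ZMod 2 => m)).real (Bad j) :=
        measureReal_iUnion_fintype_le _
    _ ≤ ∑ j : (Fin k × Fin k → ZMod 2), Real.exp (-2 * ε ^ 2 * M / C ^ 2) :=
        Finset.sum_le_sum fun j _ => hbad j
    _ = _ := by
        rw [Finset.sum_const, Finset.card_univ, nsmul_eq_mul, hcard]

open Classical in
lemma card_fiber {n n' : ℕ} (h : n ≤ n') (η : Fin n → ZMod 2) :
    (Finset.univ.filter fun x : Fin n' → ZMod 2 => restr h x = η).card = 2 ^ (n' - n) := by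
  obtain ⟨d, rfl⟩ := Nat.exists_eq_add_of_le h
  have : (Finset.univ.filter fun x : Fin (n + d) → ZMod 2 => restr h x = η)
      = Finset.univ.image fun y : Fin d → ZMod 2 => Fin.append η y := by
    ext x
    simp only [Finset.mem_filter, Finset.mem_univ, true_and, Finset.mem_image]
    constructor
    · rintro rfl
      refine ⟨fun i => x (Fin.natAdd n i), ?_⟩
      ext i
      refine Fin.addCases (fun i => ?_) (fun i => ?_) i
      · simp [restr]; rfl
      · simp
    · rintro ⟨y, rfl⟩
      ext i
      have : Fin.castLE h i = Fin.castAdd d i := rfl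
      simp [restr, this]
  rw [this, Finset.card_image_of_injective]
  · simp [ZMod.card]
  · intro y y' hy
    ext i
    have := congrFun hy (Fin.natAdd n i)
    simpa using this

lemma exists_eps (K : ℕ) (p : ℝ) (hp : 0 < p) (hp1 : p < 1) :
    ∃ ε : ℝ, 0 < ε ∧ ∀ k, 0 < k → k ≤ K → (p + ε) ^ k + ε ≤ p ^ (k - 1) := by
  have h : ∀ k ∈ Finset.Icc 1 K, ∀ᶠ ε in nhdsWithin (0 : ℝ) (Set.Ioi 0),
      (p + ε) ^ k + ε < p ^ (k - 1) := by
    intro k hk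
    have hk1 : 1 ≤ k := (Finset.mem_Icc.1 hk).1
    have hc : Continuous fun ε : ℝ => (p + ε) ^ k + ε := by fun_prop
    have h0 : (p + 0) ^ k + 0 < p ^ (k - 1) := by
      simp only [add_zero]
      exact pow_lt_pow_right_of_lt_one₀ hp hp1 (by omega)
    exact (hc.continuousAt.eventually_lt continuousAt_const h0).filter_mono nhdsWithin_le_nhds
  have h2 := (Filter.eventually_all_finset _).2 h
  obtain ⟨ε, h3, h4⟩ := (h2.and self_mem_nhdsWithin).exists
  exact ⟨ε, h4, fun k hk hkK => (h3 k (Finset.mem_Icc.2 ⟨hk, hkK⟩)).le⟩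

lemma exists_N (n K : ℕ) (D c : ℝ) (hc : 0 < c) :
    ∃ N : ℕ, n < N ∧ ∀ n', N ≤ n' →
      D * ((2 : ℝ) ^ (n' - n)) ^ K * Real.exp (-(c * (2 : ℝ) ^ (n' - n))) < 1 := by
  have h1 : Filter.Tendsto (fun n' : ℕ => c * (2 : ℝ) ^ (n' - n)) Filter.atTop Filter.atTop :=
    ((tendsto_pow_atTop_atTop_of_one_lt (by norm_num : (1 : ℝ) < 2)).comp
      (Filter.tendsto_sub_atTop_nat n)).const_mul_atTop hc
  have h2 := ((Real.tendsto_pow_mul_exp_neg_atTop_nhds_zero K).comp h1).const_mul (D / c ^ K)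
  rw [mul_zero] at h2
  have h3 := (h2.eventually_lt_const one_pos).and (Filter.eventually_gt_atTop n)
  obtain ⟨N, hN⟩ := Filter.eventually_atTop.1 h3
  refine ⟨N, (hN N le_rfl).2, fun n' hn' => ?_⟩
  have := (hN n' hn').1
  simp only [Function.comp] at this
  refine lt_of_eq_of_lt ?_ this
  rw [mul_pow]
  field_simp

open Classical in
lemma exists_good (n : ℕ) (p : ℝ) (hp : 0 < p) (hp1 : p < 1) :
    ∃ N : ℕ, n < N ∧ ∀ n' : ℕ, N ≤ n' → ∀ (h : n ≤ n'),
      ∃ ω : (Fin n' → ZMod 2) → Bool,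
        (∀ η, (2 : ℝ) ^ (n' - n) * p ≤
          (Finset.univ.filter fun x => restr h x = η ∧ ω x = true).card) ∧
        (∀ k : ℕ, 0 < k → k ≤ 2 ^ n →
          ∀ (η : Fin n → ZMod 2) (νp : Fin k → Fin n' → ZMod 2),
            Function.Injective νp →
            ((Finset.univ.filter fun x => restr h x = η ∧ ∀ l, ω (x + νp l) = true).card : ℝ) ≤
              (2 : ℝ) ^ (n' - n) * p ^ (k - 1)) := by
  set K := 2 ^ n with hK
  have hK1 : 1 ≤ K := Nat.one_le_two_pow
  obtain ⟨ε, hε, hεk⟩ := exists_eps K p hp hp1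
  have hq1 : p + ε + ε ≤ 1 := by simpa using hεk 1 one_pos hK1
  set C : ℝ := 2 ^ (K * K) with hC
  have hC0 : 0 < C := by positivity
  obtain ⟨N, hnN, hN⟩ := exists_N n K (2 * 2 ^ n * ((K + 1) * (2 ^ n) ^ K) * C) (2 * ε ^ 2 / C ^ 2)
    (by positivity)
  refine ⟨N, hnN, fun n' hn' h => ?_⟩
  set M : ℝ := 2 ^ (n' - n) with hM
  have hM0 : 0 < M := by positivity
  have hNM := hN n' hn'
  let q : unitInterval := ⟨p + ε, by constructor <;> linarith⟩
  let m : Measure Bool := bernoulliMeasure true false q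
  have hm1 : m.real {true} = p + ε := by
    simp [m, q, bernoulliMeasure_real_apply]
  have hm0 : m.real {false} = 1 - (p + ε) := by
    simp [m, q, bernoulliMeasure_real_apply]
  let J := Bool × (Fin n → ZMod 2) × (Σ k : Fin (K + 1), (Fin k → Fin n' → ZMod 2))
  let P := Measure.pi (fun _ : Fin n' → ZMod 2 => m)
  let Bad : J → Set ((Fin n' → ZMod 2) → Bool) := fun j =>
    {ω | Function.Injective j.2.2.2 ∧ ((m.real {j.1}) ^ (j.2.2.1 : ℕ) + ε) * M ≤
      (((Finset.univ.filter fun x => restr h x = j.2.1).filter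
        fun x => ∀ l, ω (x + j.2.2.2 l) = j.1).card : ℝ)}
  have hbad : ∀ j, P.real (Bad j) ≤ C * Real.exp (-(2 * ε ^ 2 / C ^ 2 * M)) := by
    rintro ⟨b, η, k, νp⟩
    by_cases hν : Function.Injective νp
    · have h1 := tail_shift m b (Finset.univ.filter fun x => restr h x = η) νp hν M ε hε hM0
        (by rw [card_fiber]; push_cast; exact le_rfl)
      have h2 : Bad ⟨b, η, k, νp⟩ ⊆ {ω | ((m.real {b}) ^ (k : ℕ) + ε) * M ≤
          (((Finset.univ.filter fun x => restr h x = η).filter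
            fun x => ∀ l, ω (x + νp l) = b).card : ℝ)} := fun ω hω => hω.2
      refine (measureReal_mono h2).trans (h1.trans ?_)
      have hkK : (k : ℕ) ≤ K := Nat.lt_succ_iff.1 k.2
      have h3 : (2 : ℝ) ^ ((k : ℕ) * k) ≤ C :=
        pow_le_pow_right₀ (by norm_num) (Nat.mul_le_mul hkK hkK)
      refine mul_le_mul h3 (Real.exp_le_exp.2 ?_) (Real.exp_nonneg _) hC0.le
      have h4 : 2 * ε ^ 2 * M / C ^ 2 ≤ 2 * ε ^ 2 * M / (2 ^ ((k : ℕ) * k)) ^ 2 := by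
        gcongr
      have h5 : -2 * ε ^ 2 * M / (2 ^ ((k : ℕ) * k)) ^ 2
        = -(2 * ε ^ 2 * M / (2 ^ ((k : ℕ) * k)) ^ 2) := by ring
      rw [h5, neg_le_neg_iff]
      calc _ = 2 * ε ^ 2 * M / C ^ 2 := by ring
        _ ≤ _ := h4
    · have : Bad ⟨b, η, k, νp⟩ = ∅ := by
        ext ω; simp [Bad, hν]
      rw [this, measureReal_empty]
      positivity
  have hJ : (Fintype.card J : ℝ) ≤ 2 * 2 ^ n * ((K + 1) * (2 ^ n) ^ K) * M ^ K := by
    have e1 : (Fintype.card J : ℝ) = 2 * (2 ^ n * ∑ k : Fin (K + 1), ((2 : ℝ) ^ n') ^ (k : ℕ)) := by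
      simp [J, ZMod.card, Fintype.card_sigma]
    have e2 : (2 : ℝ) ^ n' = 2 ^ n * M := by
      rw [hM, ← pow_add, Nat.add_sub_cancel' h]
    have e3 : ∑ k : Fin (K + 1), ((2 : ℝ) ^ n') ^ (k : ℕ) ≤ (K + 1) * (2 ^ n * M) ^ K := by
      rw [← e2]
      calc _ ≤ ∑ k : Fin (K + 1), ((2 : ℝ) ^ n') ^ K :=
            Finset.sum_le_sum fun k _ => pow_le_pow_right₀ (one_le_pow₀ (by norm_num))
              (Nat.lt_succ_iff.1 k.2)
        _ = _ := by simp
    rw [e1]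
    calc _ ≤ 2 * (2 ^ n * ((K + 1) * (2 ^ n * M) ^ K)) := by gcongr
      _ = _ := by rw [mul_pow]; ring
  have hlt : P.real (⋃ j, Bad j) < 1 := by
    calc _ ≤ ∑ j, P.real (Bad j) := measureReal_iUnion_fintype_le _
      _ ≤ ∑ j : J, C * Real.exp (-(2 * ε ^ 2 / C ^ 2 * M)) := Finset.sum_le_sum fun j _ => hbad j
      _ = Fintype.card J * (C * Real.exp (-(2 * ε ^ 2 / C ^ 2 * M))) := by
          rw [Finset.sum_const, Finset.card_univ, nsmul_eq_mul]
      _ ≤ (2 * 2 ^ n * ((K + 1) * (2 ^ n) ^ K) * M ^ K) *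
          (C * Real.exp (-(2 * ε ^ 2 / C ^ 2 * M))) := by gcongr
      _ < 1 := by
          refine lt_of_eq_of_lt ?_ hNM
          ring
  have hne : (⋃ j, Bad j) ≠ Set.univ := by
    intro he
    rw [he] at hlt
    simp [P] at hlt
  obtain ⟨ω, hω⟩ := (Set.ne_univ_iff_exists_notMem _).1 hne
  have good : ∀ (b : Bool) (η : Fin n → ZMod 2) (k : ℕ) (_ : k ≤ K)
      (νp : Fin k → Fin n' → ZMod 2), Function.Injective νp →
      ((Finset.univ.filter fun x => restr h x = η ∧ ∀ l, ω (x + νp l) = b).card : ℝ)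
        < ((m.real {b}) ^ k + ε) * M := by
    intro b η k hk νp hν
    by_contra hcon
    rw [not_lt] at hcon
    apply hω
    refine Set.mem_iUnion.2 ⟨⟨b, η, ⟨k, Nat.lt_succ_iff.2 hk⟩, νp⟩, hν, ?_⟩
    rw [Finset.filter_filter]
    exact hcon
  refine ⟨ω, fun η => ?_, fun k hk hkK η νp hν => ?_⟩
  · have h1 := good false η 1 hK1 (fun _ => 0) (fun a b _ => Subsingleton.elim a b)
    simp only [add_zero, forall_const, pow_one, hm0] at h1
    have h2 := Finset.card_filter_add_card_filter_not
      (s := Finset.univ.filter fun x : Fin n' → ZMod 2 => restr h x = η) (fun x => ω x = true)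
    rw [Finset.filter_filter, Finset.filter_filter, card_fiber] at h2
    simp only [Bool.not_eq_true] at h2
    have h3 : ((Finset.univ.filter fun x : Fin n' → ZMod 2 => restr h x = η ∧ ω x = true).card : ℝ)
      + ((Finset.univ.filter fun x : Fin n' → ZMod 2 => restr h x = η ∧ ω x = false).card : ℝ)
      = M := by
      rw [hM]; exact_mod_cast h2
    nlinarith
  · have h1 := good true η k hkK νp hν
    rw [hm1] at h1
    refine h1.le.trans ?_
    rw [mul_comm]
    exact mul_le_mul_of_nonneg_left (hεk k hk hkK) hM0.le

end Helpers

/-- Lemma 15. -/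
theorem stmt12 (n : ℕ) (p : ℝ) (hp : 0 < p) (hp1 : p < 1) :
    ∃ N : ℕ, n < N ∧ ∀ n' : ℕ, N ≤ n' → ∀ (h : n ≤ n'),
      ∀ t : Set (Fin n → ZMod 2), ∃ t' : Set (Fin n' → ZMod 2),
        (∀ ζ ∈ t', restr h ζ ∈ t) ∧
        (∀ η ∈ t, (2 : ℝ) ^ (n' - n) * p ≤ {ζ ∈ t' | restr h ζ = η}.ncard) ∧
        (∀ k : ℕ, 0 < k → k ≤ 2 ^ n →
          ∀ (η : Fin n → ZMod 2) (ν : Fin k → Fin n → ZMod 2)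
            (νp : Fin k → Fin n' → ZMod 2),
            Function.Injective νp → (∀ l, restr h (νp l) = ν l) →
            (∀ l, η + ν l ∈ t) →
            ({ηp : Fin n' → ZMod 2 | restr h ηp = η ∧ ∀ l, ηp + νp l ∈ t'}.ncard : ℝ) ≤
              (2 : ℝ) ^ (n' - n) * p ^ (k - 1)) := by
  classical
  obtain ⟨N, hnN, hN⟩ := exists_good n p hp hp1
  refine ⟨N, hnN, fun n' hn' h t => ?_⟩
  obtain ⟨ω, h2, h3⟩ := hN n' hn' h
  refine ⟨{ζ | restr h ζ ∈ t ∧ ω ζ = true}, fun ζ hζ => hζ.1, fun η hη => ?_, ?_⟩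
  · refine (h2 η).trans ?_
    rw [← Set.ncard_coe_finset]
    refine Nat.cast_le.2 (Set.ncard_le_ncard ?_ (Set.toFinite _))
    intro x hx
    simp only [Finset.coe_filter, Finset.mem_univ, true_and, Set.mem_ofPred_eq] at hx
    exact ⟨⟨by rw [hx.1]; exact hη, hx.2⟩, hx.1⟩
  · intro k hk hkK η ν νp hν _ _
    refine le_trans ?_ (h3 k hk hkK η νp hν)
    rw [← Set.ncard_coe_finset]
    refine Nat.cast_le.2 (Set.ncard_le_ncard ?_ (Set.toFinite _))
    intro x hx
    simp only [Finset.coe_filter, Finset.mem_univ, true_and, Set.mem_ofPred_eq]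
    exact ⟨hx.1, fun l => (hx.2 l).2⟩
end

section
/- Assuming the continuum hypothesis, there exists an uncountable null-additive subset of 2^ω. -/
open MeasureTheory Pointwise

open Filter in
lemma tower_step {I : Type} [LinearOrder I] (i : I) (hc : (Set.Iio i).Countable)
    (φ : I → ℕ → ℕ) (hm : ∀ j < i, StrictMono (φ j))
    (ht : ∀ j < i, ∀ k < j, ∀ᶠ n in atTop, φ j n ∈ Set.range (φ k)) (g : ℕ → ℕ) :
    ∃ ψ : ℕ → ℕ, StrictMono ψ ∧ (∀ n, g n ≤ ψ n) ∧
      ∀ j < i, ∀ᶠ n in atTop, ψ n ∈ Set.range (φ j) := by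
  obtain ⟨f, hf⟩ := Set.countable_iff_exists_injOn.1 hc
  have key : ∀ n, ∃ᶠ k in atTop, g n ≤ k ∧ ∀ j < i, f j ≤ n → k ∈ Set.range (φ j) := by
    intro n
    have hfin : {j | j < i ∧ f j ≤ n}.Finite := by
      apply Set.Finite.of_finite_image (f := f)
      · exact (Set.finite_Iic n).subset (by rintro _ ⟨j, hj, rfl⟩; exact hj.2)
      · intro a ha b hb; exact hf ha.1 hb.1
    refine Frequently.and_eventually ?_ ?_ |>.mono fun k h => ⟨h.2, h.1⟩
    · rcases Set.eq_empty_or_nonempty {j | j < i ∧ f j ≤ n} with he | hne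
      · refine Eventually.frequently (Eventually.of_forall fun k j hj hjn => ?_)
        exact absurd (show j ∈ {j | j < i ∧ f j ≤ n} from ⟨hj, hjn⟩) (by rw [he]; simp)
      · obtain ⟨m, hmm, hmax⟩ := hfin.exists_maximal hne
        have h1 : ∀ᶠ k in atTop, ∀ j ∈ hfin.toFinset, φ m k ∈ Set.range (φ j) := by
          rw [eventually_all_finset]
          intro j hj
          have hj' : j < i ∧ f j ≤ n := by simpa using hj
          rcases lt_or_ge j m with h | h
          · exact ht m hmm.1 j h
          · have : j = m := le_antisymm (hmax hj' h) h
            subst this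
            exact Eventually.of_forall fun k => ⟨k, rfl⟩
        have h2 := (hm m hmm.1).tendsto_atTop.frequently (p := fun k => ∀ j < i, f j ≤ n → k ∈ Set.range (φ j)) 
          (h1.frequently.mono fun k hk j hj hjn => hk j (by simpa using ⟨hj, hjn⟩))
        exact h2
    · exact eventually_ge_atTop _
  obtain ⟨ψ, hψ, hP⟩ := extraction_forall_of_frequently key
  refine ⟨ψ, hψ, fun n => (hP n).1, fun j hj => ?_⟩
  filter_upwards [eventually_ge_atTop (f j)] with n hn
  exact (hP n).2 j hj hn

open Filter in
lemma tower {I : Type} [LinearOrder I] [WellFoundedLT I] (hc : ∀ i : I, (Set.Iio i).Countable)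
    (G : I → ℕ → ℕ) :
    ∃ φ : I → ℕ → ℕ, ∀ i, StrictMono (φ i) ∧ (∀ n, G i n ≤ φ i n) ∧
      ∀ j < i, ∀ᶠ n in atTop, φ i n ∈ Set.range (φ j) := by
  classical
  let Q : (i : I) → ((j : I) → j < i → ℕ → ℕ) → (ℕ → ℕ) → Prop := fun i p ψ =>
    StrictMono ψ ∧ (∀ n, G i n ≤ ψ n) ∧ ∀ j (hj : j < i), ∀ᶠ n in atTop, ψ n ∈ Set.range (p j hj)
  let F : (i : I) → ((j : I) → j < i → ℕ → ℕ) → ℕ → ℕ := fun i p =>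
    if h : ∃ ψ, Q i p ψ then h.choose else id
  have wf : WellFounded ((· < ·) : I → I → Prop) := wellFounded_lt
  let φ : I → ℕ → ℕ := wf.fix F
  have hφ : ∀ i, φ i = F i (fun j _ => φ j) := fun i => wf.fix_eq F i
  refine ⟨φ, fun i => ?_⟩
  induction i using wf.induction with
  | _ i ih =>
    have hex : ∃ ψ, Q i (fun j _ => φ j) ψ :=
      tower_step i (hc i) φ (fun j hj => (ih j hj).1) (fun j hj => (ih j hj).2.2) (G i)
    have : φ i = hex.choose := by rw [hφ]; exact dif_pos hex
    rw [this]
    exact hex.choose_spec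

/-- `C` depends only on the first `j` coordinates. -/
def DepOn (C : Set Cantor) (j : ℕ) : Prop := ∀ x y : Cantor, (∀ i < j, y i = x i) → x ∈ C → y ∈ C

lemma DepOn.isOpen {C : Set Cantor} {j : ℕ} (h : DepOn C j) : IsOpen C := by
  rw [isOpen_iff_forall_mem_open]
  intro x hx
  exact ⟨PiNat.cylinder x j, fun y hy => h x y hy hx, PiNat.isOpen_cylinder _ x j,
    PiNat.self_mem_cylinder x j⟩

instance : Measure.IsAddHaarMeasure μC := by unfold μC; infer_instance
instance : Measure.Regular μC := by unfold μC; infer_instance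

lemma open_decomp (U : Set Cantor) (hU : IsOpen U) :
    ∃ C : ℕ → Set Cantor, (∀ j, DepOn (C j) j) ∧ U = ⋃ j, C j ∧ ∑' j, μC (C j) = μC U := by
  let V : ℕ → Set Cantor := fun j => {x | PiNat.cylinder x j ⊆ U}
  have hV : ∀ j, DepOn (V j) j := by
    intro j x y hxy hx
    have : PiNat.cylinder y j = PiNat.cylinder x j := PiNat.mem_cylinder_iff_eq.1 hxy
    change PiNat.cylinder y j ⊆ U
    rw [this]; exact hx
  have hmono : ∀ i j, i ≤ j → DepOn (V i) j := fun i j hij x y hxy =>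
    hV i x y fun k hk => hxy k (hk.trans_le hij)
  have hUV : U = ⋃ j, V j := by
    ext x
    simp only [Set.mem_iUnion]
    constructor
    · intro hx
      obtain ⟨s, ⟨y, n, rfl⟩, hxs, hs⟩ :=
        (PiNat.isTopologicalBasis_cylinders (fun _ : ℕ => ZMod 2)).exists_subset_of_mem_open hx hU
      refine ⟨n, ?_⟩
      change PiNat.cylinder x n ⊆ U
      rw [PiNat.mem_cylinder_iff_eq.1 hxs]; exact hs
    · rintro ⟨j, hj⟩
      exact hj (PiNat.self_mem_cylinder x j)
  refine ⟨disjointed V, ?_, ?_, ?_⟩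
  · intro j x y hxy hx
    rw [disjointed_eq_inter_compl] at hx ⊢
    simp only [Set.mem_inter_iff, Set.mem_iInter, Set.mem_compl_iff] at hx ⊢
    exact ⟨hV j x y hxy hx.1, fun i hi hy =>
      hx.2 i hi (hmono i j hi.le y x (fun k hk => (hxy k hk).symm) hy)⟩
  · rw [iUnion_disjointed, hUV]
  · rw [← measure_iUnion (disjoint_disjointed V)
      (fun n => MeasurableSet.disjointed (fun i => (hV i).isOpen.measurableSet) n),
      iUnion_disjointed, ← hUV]

/-- Points supported in `S`. -/
def Supp (S : Set ℕ) : Set Cantor := {x | ∀ n ∉ S, x n = 0}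

lemma measure_add_set (x : Cantor) (A : Set Cantor) : μC ({x} + A) = μC A := by
  rw [Set.singleton_add, Set.image_add_left]
  exact measure_preimage_add μC (-x) A

open Classical in
lemma supp_add_le (φ : ℕ → ℕ) (hφ : StrictMono φ) (C : Set Cantor) (j : ℕ) (hC : DepOn C j) :
    μC (Supp (Set.range φ) + C) ≤ μC C + ∑' i, (if φ i < j then (2 : ENNReal) ^ i * μC C else 0) := by
  have hex : ∃ c, j ≤ φ c := ⟨j, hφ.le_apply⟩
  let c := Nat.find hex
  have h1 : ∀ i < c, φ i < j := fun i hi => not_le.1 (Nat.find_min hex hi)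
  have h2 : ∀ i, c ≤ i → j ≤ φ i := fun i hi => (Nat.find_spec hex).trans (hφ.monotone hi)
  have hsub : Supp (Set.range φ) + C ⊆
      ⋃ s ∈ (Finset.range c).powerset, ({fun n => if n ∈ s.image φ then 1 else 0} + C) := by
    rintro _ ⟨p, hp, y, hy, rfl⟩
    simp only [Set.mem_iUnion]
    refine ⟨(Finset.range c).filter (fun i => p (φ i) = 1), by simp, ?_⟩
    set q : Cantor := fun n => if n ∈ ((Finset.range c).filter (fun i => p (φ i) = 1)).image φ
      then 1 else 0 with hq
    refine ⟨q, rfl, -q + (p + y), ?_, by simp⟩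
    apply hC y _ _ hy
    intro n hn
    have : q n = p n := by
      simp only [hq]
      split_ifs with h
      · simp only [Finset.mem_image, Finset.mem_filter, Finset.mem_range] at h
        obtain ⟨i, ⟨_, h⟩, rfl⟩ := h
        exact h.symm
      · by_cases hr : n ∈ Set.range φ
        · obtain ⟨i, rfl⟩ := hr
          have hi : i < c := by
            by_contra hh
            exact absurd (h2 i (not_lt.1 hh)) (not_le.2 hn)
          have : p (φ i) ≠ 1 := fun h' => h (by
            simp only [Finset.mem_image, Finset.mem_filter, Finset.mem_range]
            exact ⟨i, ⟨hi, h'⟩, rfl⟩)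
          generalize p (φ i) = z at *
          revert this; revert z; decide
        · exact (hp n hr).symm
    change -q n + (p n + y n) = y n
    rw [this, neg_add_cancel_left]
  calc μC (Supp (Set.range φ) + C) ≤ _ := measure_mono hsub
    _ ≤ _ := measure_biUnion_finset_le _ _
    _ = 2 ^ c * μC C := by simp
    _ = μC C + ∑ i ∈ Finset.range c, (2 : ENNReal) ^ i * μC C := by
      have : ∀ c : ℕ, (2 : ENNReal) ^ c * μC C = μC C + ∑ i ∈ Finset.range c, (2 : ENNReal) ^ i * μC C := by
        intro c
        induction c with
        | zero => simp
        | succ c ih => rw [Finset.sum_range_succ, ← add_assoc, ← ih, pow_succ]; ring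
      exact this c
    _ = μC C + ∑ i ∈ Finset.range c, (if φ i < j then (2 : ENNReal) ^ i * μC C else 0) := by
      congr 1
      exact Finset.sum_congr rfl fun i hi => by rw [if_pos (h1 i (Finset.mem_range.1 hi))]
    _ ≤ _ := by gcongr; exact ENNReal.sum_le_tsum _

lemma tail_small (T : ℕ → ENNReal) (hT : ∑' j, T j ≠ ⊤) (ε : ENNReal) (hε : 0 < ε) :
    ∃ N, ∑' j, (if N < j then T j else 0) ≤ ε := by
  have h := ENNReal.tendsto_sum_nat_add T hT
  obtain ⟨N, hN⟩ := (h.eventually (gt_mem_nhds hε)).exists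
  refine ⟨N, le_trans ?_ hN.le⟩
  have hs := (ENNReal.summable (f := fun k => if N < k + N then T (k + N) else 0)).sum_add_tsum_nat_add'
    (f := fun j => if N < j then T j else 0)
  have h0 : ∑ j ∈ Finset.range N, (if N < j then T j else 0) = 0 := by
    apply Finset.sum_eq_zero
    intro i hi
    have := Finset.mem_range.1 hi
    exact if_neg (by omega)
  rw [← hs, h0, zero_add]
  apply ENNReal.tsum_le_tsum
  intro k
  by_cases hk : N < k + N
  · simp only [if_pos hk, le_refl]
  · simp only [if_neg hk, zero_le]

lemma key (A : Set Cantor) (hA : μC A = 0) :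
    ∃ g : ℕ → ℕ, ∀ φ : ℕ → ℕ, StrictMono φ → (∀ n, g n ≤ φ n) →
      μC (Supp (Set.range φ) + A) = 0 := by
  obtain ⟨ε, hε, hεs⟩ := ENNReal.exists_pos_sum_of_countable (ε := 1) one_ne_zero ℕ
  have hU : ∀ m, ∃ U ⊇ A, IsOpen U ∧ μC U < ε m := fun m =>
    A.exists_isOpen_lt_of_lt (ε m) (by rw [hA]; exact_mod_cast hε m)
  choose U hAU hUo hUm using hU
  choose C hC hUC hsum using fun m => open_decomp (U m) (hUo m)
  let T : ℕ → ENNReal := fun j => ∑' m, μC (C m j)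
  have hT : ∑' j, T j ≠ ⊤ := by
    have : ∑' j, T j ≤ 1 := by
      simp only [T]
      rw [ENNReal.tsum_comm]
      simp only [hsum]
      exact (ENNReal.tsum_le_tsum fun m => (hUm m).le).trans hεs.le
    exact ne_top_of_le_ne_top ENNReal.one_ne_top this
  choose g hg using fun i : ℕ => tail_small T hT ((4 : ENNReal)⁻¹ ^ i)
    (ENNReal.pow_pos (by simp) i)
  refine ⟨g, fun φ hφ hgφ => ?_⟩
  have hfin : ∑' p : ℕ × ℕ, μC (Supp (Set.range φ) + C p.1 p.2) ≠ ⊤ := by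
    classical
    rw [ENNReal.tsum_prod (f := fun m j => μC (Supp (Set.range φ) + C m j)), ENNReal.tsum_comm]
    have hle : ∀ j, ∑' m, μC (Supp (Set.range φ) + C m j) ≤
        T j + ∑' i, (if φ i < j then (2 : ENNReal) ^ i * T j else 0) := by
      intro j
      calc _ ≤ ∑' m, (μC (C m j) + ∑' i, (if φ i < j then (2 : ENNReal) ^ i * μC (C m j) else 0)) :=
            ENNReal.tsum_le_tsum fun m => by
              convert supp_add_le φ hφ (C m j) j (hC m j)
        _ = _ := by
          rw [ENNReal.tsum_add, ENNReal.tsum_comm]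
          congr 2
          ext i
          split_ifs
          · rw [ENNReal.tsum_mul_left]
          · simp
    refine ne_top_of_le_ne_top ?_ (ENNReal.tsum_le_tsum hle)
    rw [ENNReal.tsum_add, ENNReal.tsum_comm (f := fun j i => if φ i < j then (2 : ENNReal) ^ i * T j else 0)]
    refine ENNReal.add_ne_top.2 ⟨hT, ?_⟩
    have hle2 : ∀ i, ∑' j, (if φ i < j then (2 : ENNReal) ^ i * T j else 0) ≤ (2⁻¹ : ENNReal) ^ i := by
      intro i
      calc _ ≤ ∑' j, (2 : ENNReal) ^ i * (if g i < j then T j else 0) :=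
            ENNReal.tsum_le_tsum fun j => by
              have := hgφ i
              by_cases h1 : φ i < j
              · rw [if_pos h1, if_pos (by omega)]
              · rw [if_neg h1]; exact zero_le
        _ ≤ 2 ^ i * 4⁻¹ ^ i := by rw [ENNReal.tsum_mul_left]; gcongr; exact hg i
        _ = _ := by
          rw [← mul_pow]
          congr 1
          rw [show (4 : ENNReal) = 2 * 2 by norm_num, ENNReal.mul_inv (by simp) (by simp),
            ← mul_assoc, ENNReal.mul_inv_cancel (by simp) (by simp), one_mul]
    refine ne_top_of_le_ne_top ?_ (ENNReal.tsum_le_tsum hle2)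
    rw [ENNReal.tsum_geometric]
    simp
  have hae := ae_finite_setOfPred_mem hfin
  refine measure_mono_null ?_ (ae_iff.1 hae)
  rintro _ ⟨p, hp, a, ha, rfl⟩
  change ¬ Set.Finite _
  have : ∀ m, ∃ j, a ∈ C m j := fun m => by
    have := hAU m ha
    rw [hUC m] at this
    simpa using this
  choose J hJ using this
  refine (Set.infinite_range_of_injective (f := fun m => (m, J m))
    (fun m n h => (Prod.mk.inj h).1)).mono ?_
  rintro _ ⟨m, rfl⟩
  exact ⟨p, hp, a, hJ m, rfl⟩

/-- Theorem 19: assuming CH there is an uncountable null-additive set. -/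
theorem stmt17 (hCH : Cardinal.continuum = Cardinal.aleph 1) :
    ∃ X : Set Cantor, ¬ X.Countable ∧ NullAdditive X := by
  classical
  have hCH0 : Cardinal.continuum.{0} = Cardinal.aleph 1 := by
    apply Cardinal.lift_injective
    simpa using hCH
  let I : Type := (Cardinal.aleph 1).ord.ToType
  have hcI : ∀ i : I, (Set.Iio i).Countable := fun i => by
    rw [Cardinal.countable_iff_lt_aleph_one]
    exact Cardinal.mk_Iio_toType_ord_lt i
  have hcard : Cardinal.mk I = Cardinal.mk (ℕ → ℕ) := by
    rw [Cardinal.mk_ord_toType, ← hCH0]; simp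
  obtain ⟨e⟩ := Cardinal.eq.1 hcard
  obtain ⟨φ, hφ⟩ := tower hcI (fun i => e i)
  let x : I → Cantor := fun i n => if n ∈ Set.range (φ i) then 1 else 0
  have hx1 : ∀ i n, x i n = 1 ↔ n ∈ Set.range (φ i) := fun i n => by
    simp only [x]; split_ifs with h <;> simp [h]
  have hxinj : ∀ i j, x i = x j → φ i = φ j := fun i j h => by
    rw [← (hφ i).1.range_inj (hφ j).1]
    ext n
    rw [← hx1, ← hx1, h]
  refine ⟨Set.range x, fun hcount => ?_, fun A hA => ?_⟩
  · have hne : (Set.range x).Nonempty := ⟨_, e.symm id, rfl⟩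
    obtain ⟨f, hf⟩ := hcount.exists_eq_range hne
    have : ∀ n, ∃ i, x i = f n := fun n => by
      have : f n ∈ Set.range x := hf ▸ ⟨n, rfl⟩
      exact this
    choose i hi using this
    let g : ℕ → ℕ := fun n => φ (i n) n + 1
    have hmem : x (e.symm g) ∈ Set.range f := hf ▸ ⟨_, rfl⟩
    obtain ⟨m, hm⟩ := hmem
    have h1 := hxinj _ _ ((hi m).trans hm)
    have h2 := (hφ (e.symm g)).2.1 m
    rw [← h1, Equiv.apply_symm_apply] at h2
    simp only [g] at h2
    omega
  · obtain ⟨g, hg⟩ := key A hA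
    set i₀ := e.symm g with hi₀
    have hP := hg (φ i₀) (hφ i₀).1 (fun n => by
      have := (hφ i₀).2.1 n
      rwa [hi₀, Equiv.apply_symm_apply] at this)
    have hcIic : (Set.Iic i₀).Countable := by
      rw [← Set.Iio_insert]; exact (hcI i₀).insert _
    have hsub : Set.range x + A ⊆ (⋃ i ∈ Set.Iic i₀, ({x i} + A)) ∪
        ⋃ F : Finset ℕ, ({fun n => if n ∈ F then 1 else 0} + (Supp (Set.range (φ i₀)) + A)) := by
      rintro _ ⟨_, ⟨i, rfl⟩, a, ha, rfl⟩
      rcases le_or_gt i i₀ with h | h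
      · left
        simp only [Set.mem_iUnion]
        exact ⟨i, h, x i, rfl, a, ha, rfl⟩
      · right
        simp only [Set.mem_iUnion]
        obtain ⟨N, hN⟩ := Filter.eventually_atTop.1 ((hφ i).2.2 i₀ h)
        let F := (Finset.range N).image (φ i)
        refine ⟨F, _, rfl, (fun n => if n ∈ F then 0 else x i n) + a,
          ⟨_, ?_, a, ha, rfl⟩, ?_⟩
        · intro n hn
          by_cases hF : n ∈ F
          · simp [hF]
          · simp only [hF, if_false, x]
            rw [if_neg]
            rintro ⟨k, rfl⟩
            rcases lt_or_ge k N with hk | hk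
            · exact hF (Finset.mem_image_of_mem _ (Finset.mem_range.2 hk))
            · exact hn (hN k hk)
        · ext n
          by_cases hF : n ∈ F
          · have : x i n = 1 := by
              rw [hx1]
              obtain ⟨k, _, rfl⟩ := Finset.mem_image.1 hF
              exact ⟨k, rfl⟩
            simp [hF, this]
          · simp [hF]
    refine measure_mono_null hsub (measure_union_null ?_ ?_)
    · rw [measure_biUnion_null_iff hcIic]
      intro i _
      rw [measure_add_set, hA]
    · rw [measure_iUnion_null_iff]
      intro F
      rw [measure_add_set, hP]
end
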